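/- arXiv:2405.12088 — 2 statements merged into one kernel-verified Lean document; each statement's English description precedes it below -/
import Mathlib

section
/- There exist positive real constants c1 and c2 such that for every sufficiently large positive integer n, π(n) + π(⌊n/2⌋) + c1·n^{5/6}/(log n)^{5/3} ≤ F_{9,3}(n) ≤ π(n) + π(⌊n/2⌋) + c2·n^{5/6}. -/
open Finset Filter

/-- `Fkd k d n` is the maximum cardinality of a set `A ⊆ {1,…,n}` such that there are no
`a_1 < a_2 < ⋯ < a_k` in `A` and positive integer `x` with `a_1 ⋯ a_k = x ^ d`. -/
noncomputable def Fkd (k d n : ℕ) : ℕ :=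
  sSup {m : ℕ | ∃ A : Finset ℕ, A ⊆ Finset.Icc 1 n ∧ A.card = m ∧
    ∀ (a : Fin k → ℕ) (x : ℕ), (∀ i, a i ∈ A) → StrictMono a → 0 < x →
      (∏ i, a i) ≠ x ^ d}



/-- No complete bipartite `K_{3,3}` inside the edge set `E`. -/
def K33Free {α β : Type*} (E : Finset (α × β)) : Prop :=
  ∀ (T : Finset α) (S : Finset β), T.card = 3 → S.card = 3 →
    ¬ (∀ t ∈ T, ∀ s ∈ S, (t, s) ∈ E)

section brown
variable {F : Type*} [Field F]

lemma noline (c : F) (hc : ¬ IsSquare c) (a1 a2 a3 v1 v2 v3 : F)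
    (hv : v1 * v2 + v3 ^ 2 = 0) (ha : a1 * a2 + a3 ^ 2 = c)
    (hb : a1 * v2 + a2 * v1 + 2 * a3 * v3 = 0) : v1 = 0 ∧ v2 = 0 ∧ v3 = 0 := by
  have h1 : v1 = 0 := by
    by_contra h
    apply hc
    refine ⟨(v1 * a3 - a1 * v3) / v1, ?_⟩
    field_simp
    subst ha
    linear_combination (a1 * v1) * hb - (a1 ^ 2) * hv
  have h2 : v2 = 0 := by
    by_contra h
    apply hc
    refine ⟨(v2 * a3 - a2 * v3) / v2, ?_⟩
    field_simp
    subst ha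
    linear_combination (a2 * v2) * hb - (a2 ^ 2) * hv
  refine ⟨h1, h2, ?_⟩
  subst h1
  simpa using hv

lemma nocoll (c : F) (hc : ¬ IsSquare c) (a1 a2 a3 v1 v2 v3 t : F)
    (h0 : a1 * a2 + a3 ^ 2 = c)
    (h1 : (a1 + v1) * (a2 + v2) + (a3 + v3) ^ 2 = c)
    (h2 : (a1 + t * v1) * (a2 + t * v2) + (a3 + t * v3) ^ 2 = c) (ht0 : t ≠ 0) (ht1 : t ≠ 1) :
    v1 = 0 ∧ v2 = 0 ∧ v3 = 0 := by
  have e1 : (a1 * v2 + a2 * v1 + 2 * a3 * v3) + (v1 * v2 + v3 ^ 2) = 0 := by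
    linear_combination h1 - h0
  have e2 : (a1 * v2 + a2 * v1 + 2 * a3 * v3) + t * (v1 * v2 + v3 ^ 2) = 0 := by
    have : t * ((a1 * v2 + a2 * v1 + 2 * a3 * v3) + t * (v1 * v2 + v3 ^ 2)) = 0 := by
      linear_combination h2 - h0
    exact (mul_eq_zero.mp this).resolve_left ht0
  have e3 : v1 * v2 + v3 ^ 2 = 0 := by
    have : (t - 1) * (v1 * v2 + v3 ^ 2) = 0 := by linear_combination e2 - e1
    exact (mul_eq_zero.mp this).resolve_left (sub_ne_zero.mpr ht1)
  exact noline c hc a1 a2 a3 v1 v2 v3 e3 h0 (by linear_combination e1 - e3)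

lemma cross0 (v1 v2 v3 w1 w2 w3 : F) (h12 : v1 * w2 = v2 * w1) (h13 : v1 * w3 = v3 * w1)
    (h23 : v2 * w3 = v3 * w2) (hv : ¬ (v1 = 0 ∧ v2 = 0 ∧ v3 = 0)) :
    ∃ t, w1 = t * v1 ∧ w2 = t * v2 ∧ w3 = t * v3 := by
  by_cases h1 : v1 = 0
  · by_cases h2 : v2 = 0
    · have h3 : v3 ≠ 0 := fun h => hv ⟨h1, h2, h⟩
      refine ⟨w3 / v3, ?_, ?_, ?_⟩ <;> field_simp
      · linear_combination -h13
      · linear_combination -h23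
    · refine ⟨w2 / v2, ?_, ?_, ?_⟩ <;> field_simp
      · linear_combination -h12
      · linear_combination h23
  · refine ⟨w1 / v1, ?_, ?_, ?_⟩ <;> field_simp
    · linear_combination h12
    · linear_combination h13

/-- the Brown-type relation -/
def BR (c : F) (x y : F × F × F) : Prop :=
  (x.1 - y.1) * (x.2.1 - y.2.1) + (x.2.2 - y.2.2) ^ 2 = c

lemma BR_coll (c : F) (hc : ¬ IsSquare c) (a1 a2 a3 d1 d2 d3 e1 e2 e3 : F)
    (h0 : a1 * a2 + a3 ^ 2 = c)
    (h1 : (a1 + d1) * (a2 + d2) + (a3 + d3) ^ 2 = c)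
    (h2 : (a1 + e1) * (a2 + e2) + (a3 + e3) ^ 2 = c)
    (hd : ¬ (d1 = 0 ∧ d2 = 0 ∧ d3 = 0)) (he : ¬ (e1 = 0 ∧ e2 = 0 ∧ e3 = 0))
    (hde : ¬ (e1 = d1 ∧ e2 = d2 ∧ e3 = d3)) 
    (h12 : d1 * e2 = d2 * e1) (h13 : d1 * e3 = d3 * e1)
    (h23 : d2 * e3 = d3 * e2) : False := by
  obtain ⟨t, rfl, rfl, rfl⟩ := cross0 d1 d2 d3 e1 e2 e3 h12 h13 h23 hd
  exact hd (nocoll c hc a1 a2 a3 d1 d2 d3 t h0 h1 h2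
    (by rintro rfl; simp at he) (by rintro rfl; simp at hde))

lemma BR_K33 (h2 : (2 : F) ≠ 0) (c : F) (hc : ¬ IsSquare c) (x y z u v w : F × F × F)
    (hxy : x ≠ y) (hxz : x ≠ z) (hyz : y ≠ z) (huv : u ≠ v) (huw : u ≠ w) (hvw : v ≠ w)
    (a1 : BR c x u) (a2 : BR c x v) (a3 : BR c x w)
    (b1 : BR c y u) (b2 : BR c y v) (b3 : BR c y w)
    (c1 : BR c z u) (c2 : BR c z v) (c3 : BR c z w) : False := by
  obtain ⟨x1, x2, x3⟩ := x
  obtain ⟨y1, y2, y3⟩ := y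
  obtain ⟨z1, z2, z3⟩ := z
  obtain ⟨u1, u2, u3⟩ := u
  obtain ⟨v1, v2, v3⟩ := v
  obtain ⟨w1, w2, w3⟩ := w
  simp only [BR] at *
  simp only [ne_eq, Prod.mk.injEq] at *
  -- orthogonality
  have o1 : (y1 - x1) * (v2 - u2) + (y2 - x2) * (v1 - u1) + 2 * (y3 - x3) * (v3 - u3) = 0 := by
    linear_combination b1 - b2 - a1 + a2
  have o2 : (y1 - x1) * (w2 - u2) + (y2 - x2) * (w1 - u1) + 2 * (y3 - x3) * (w3 - u3) = 0 := by
    linear_combination b1 - b3 - a1 + a3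
  have o3 : (z1 - x1) * (v2 - u2) + (z2 - x2) * (v1 - u1) + 2 * (z3 - x3) * (v3 - u3) = 0 := by
    linear_combination c1 - c2 - a1 + a2
  have o4 : (z1 - x1) * (w2 - u2) + (z2 - x2) * (w1 - u1) + 2 * (z3 - x3) * (w3 - u3) = 0 := by
    linear_combination c1 - c3 - a1 + a3
  have key : ∀ d1 d2 d3 e1 e2 e3 : F,
      d1 = y1 - x1 → d2 = y2 - x2 → d3 = y3 - x3 → e1 = z1 - x1 → e2 = z2 - x2 → e3 = z3 - x3 →
      (d1 * e2 = d2 * e1 ∧ d1 * e3 = d3 * e1 ∧ d2 * e3 = d3 * e2) → False := by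
    rintro d1 d2 d3 e1 e2 e3 rfl rfl rfl rfl rfl rfl ⟨p, q, r⟩
    refine BR_coll c hc (x1 - u1) (x2 - u2) (x3 - u3) _ _ _ _ _ _ a1
      (by linear_combination b1) (by linear_combination c1) ?_ ?_ ?_ p q r
    · simp only [sub_eq_zero]; exact fun h => hxy ⟨h.1.symm, h.2.1.symm, h.2.2.symm⟩
    · simp only [sub_eq_zero]; exact fun h => hxz ⟨h.1.symm, h.2.1.symm, h.2.2.symm⟩
    · simp only [sub_left_inj]; exact fun h => hyz ⟨h.1.symm, h.2.1.symm, h.2.2.symm⟩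
  by_cases hn : ((y1 - x1) * (z2 - x2) = (y2 - x2) * (z1 - x1) ∧
      (y1 - x1) * (z3 - x3) = (y3 - x3) * (z1 - x1) ∧ 
      (y2 - x2) * (z3 - x3) = (y3 - x3) * (z2 - x2))
  · exact key _ _ _ _ _ _ rfl rfl rfl rfl rfl rfl hn
  -- dual directions
  generalize hd1 : y1 - x1 = d1 at *
  generalize hd2 : y2 - x2 = d2 at *
  generalize hd3 : y3 - x3 = d3 at *
  generalize he1 : z1 - x1 = e1 at *
  generalize he2 : z2 - x2 = e2 at *
  generalize he3 : z3 - x3 = e3 at *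
  have hn' : ¬ (2 * (d1 * e3 - d3 * e1) = 0 ∧ 2 * (d3 * e2 - d2 * e3) = 0 ∧
      d2 * e1 - d1 * e2 = 0) := by
    rintro ⟨p, q, r⟩
    apply hn
    have p' := (mul_eq_zero.mp p).resolve_left h2
    have q' := (mul_eq_zero.mp q).resolve_left h2
    exact ⟨by linear_combination -r, by linear_combination p', by linear_combination -q'⟩
  obtain ⟨s, s1, s2, s3⟩ := cross0 _ _ _ (v1 - u1) (v2 - u2) (v3 - u3)
    (by linear_combination 2 * e3 * o1 - 2 * d3 * o3) (by linear_combination d1 * o3 - e1 * o1)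
    (by linear_combination e2 * o1 - d2 * o3) hn'
  obtain ⟨t, t1, t2, t3⟩ := cross0 _ _ _ (w1 - u1) (w2 - u2) (w3 - u3)
    (by linear_combination 2 * e3 * o2 - 2 * d3 * o4) (by linear_combination d1 * o4 - e1 * o2)
    (by linear_combination e2 * o2 - d2 * o4) hn'
  refine BR_coll c hc (u1 - x1) (u2 - x2) (u3 - x3) (v1 - u1) (v2 - u2) (v3 - u3)
    (w1 - u1) (w2 - u2) (w3 - u3) (by linear_combination a1)
      (by linear_combination a2) (by linear_combination a3) ?_ ?_ ?_ ?_ ?_ ?_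
  · simp only [sub_eq_zero]; exact fun h => huv ⟨h.1.symm, h.2.1.symm, h.2.2.symm⟩
  · simp only [sub_eq_zero]; exact fun h => huw ⟨h.1.symm, h.2.1.symm, h.2.2.symm⟩
  · simp only [sub_left_inj]; exact fun h => hvw ⟨h.1.symm, h.2.1.symm, h.2.2.symm⟩
  · rw [s1, s2, t1, t2]; ring
  · rw [s1, s3, t1, t3]; ring
  · rw [s2, s3, t2, t3]; ring

end brown

lemma brown_graph (q : ℕ) (hq : q.Prime) (hq2 : q ≠ 2) :
    ∃ E : Finset ((ZMod q × ZMod q × ZMod q) × (ZMod q × ZMod q × ZMod q)), K33Free E ∧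
      q ^ 4 * (q - 1) ≤ E.card := by
  classical
  have : Fact q.Prime := ⟨hq⟩
  obtain ⟨c, hc⟩ := FiniteField.exists_nonsquare (F := ZMod q) (by rwa [ZMod.ringChar_zmod_n])
  have h2 : (2 : ZMod q) ≠ 0 := by
    intro h
    have : ((2 : ℕ) : ZMod q) = 0 := by exact_mod_cast h
    rw [ZMod.natCast_eq_zero_iff] at this
    exact hq2 ((Nat.prime_dvd_prime_iff_eq hq Nat.prime_two).mp this)
  refine ⟨Finset.univ.filter (fun e => BR c e.1 e.2), ?_, ?_⟩
  · intro T S hT hS h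
    obtain ⟨x, y, z, hxy, hxz, hyz, rfl⟩ := Finset.card_eq_three.mp hT
    obtain ⟨u, v, w, huv, huw, hvw, rfl⟩ := Finset.card_eq_three.mp hS
    simp only [Finset.mem_insert, Finset.mem_singleton, Finset.mem_filter, Finset.mem_univ,
      true_and, forall_eq_or_imp, forall_eq] at h
    obtain ⟨⟨a1, a2, a3⟩, ⟨b1, b2, b3⟩, ⟨c1, c2, c3⟩⟩ := h
    exact BR_K33 h2 c hc x y z u v w hxy hxz hyz huv huw hvw a1 a2 a3 b1 b2 b3 c1 c2 c3
  · let f : (ZMod q × ZMod q × ZMod q) × ZMod q × (ZMod q)ˣ →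
        (ZMod q × ZMod q × ZMod q) × (ZMod q × ZMod q × ZMod q) := fun p =>
      (p.1, (p.1.1 - (p.2.2 : ZMod q), p.1.2.1 - (c - p.2.1 ^ 2) / (p.2.2 : ZMod q),
        p.1.2.2 - p.2.1))
    have hf : Function.Injective f := by
      rintro ⟨x, a, u⟩ ⟨y, b, v⟩ h
      simp only [f, Prod.mk.injEq] at h
      obtain ⟨rfl, h1, -, h3⟩ := h
      simp only [sub_right_inj] at h1 h3
      rw [h3, Units.ext h1]
    have hc1 : (Finset.univ.image f).card = q ^ 4 * (q - 1) := by
      rw [Finset.card_image_of_injective _ hf, Finset.card_univ]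
      simp only [Fintype.card_prod, ZMod.card, ZMod.card_units]
      ring
    rw [← hc1]
    apply Finset.card_le_card
    intro e he
    simp only [Finset.mem_image, Finset.mem_univ, true_and] at he
    obtain ⟨⟨x, a, u⟩, rfl⟩ := he
    refine Finset.mem_filter.mpr ⟨Finset.mem_univ _, ?_⟩
    simp only [BR, f]
    have : (u : ZMod q) ≠ 0 := u.ne_zero
    field_simp
    ring


lemma brown_transfer (q : ℕ) (hq : q.Prime) (hq2 : q ≠ 2) (P1 P2 : Finset ℕ)
    (h1 : q ^ 3 ≤ P1.card) (h2 : q ^ 3 ≤ P2.card) :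
    ∃ E : Finset (ℕ × ℕ), E ⊆ P1 ×ˢ P2 ∧ K33Free E ∧ q ^ 4 * (q - 1) ≤ E.card := by
  classical
  have : Fact q.Prime := ⟨hq⟩
  obtain ⟨E, hE, hEc⟩ := brown_graph q hq hq2
  have hcard : Fintype.card (ZMod q × ZMod q × ZMod q) = q ^ 3 := by
    simp only [Fintype.card_prod, ZMod.card]; ring
  obtain ⟨f⟩ : Nonempty ((ZMod q × ZMod q × ZMod q) ↪ P1) :=
    Function.Embedding.nonempty_of_card_le (by rw [hcard, Fintype.card_coe]; exact h1)
  obtain ⟨g⟩ : Nonempty ((ZMod q × ZMod q × ZMod q) ↪ P2) :=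
    Function.Embedding.nonempty_of_card_le (by rw [hcard, Fintype.card_coe]; exact h2)
  let F := f.trans (Function.Embedding.subtype _)
  let G := g.trans (Function.Embedding.subtype _)
  have hF : ∀ x, F x ∈ P1 := fun x => (f x).2
  have hG : ∀ x, G x ∈ P2 := fun x => (g x).2
  refine ⟨E.map (F.prodMap G), ?_, ?_, ?_⟩
  · intro e he
    obtain ⟨⟨a, b⟩, -, rfl⟩ := Finset.mem_map.mp he
    exact Finset.mem_product.mpr ⟨hF a, hG b⟩
  · intro T S hT hS h
    have hTn : T.Nonempty := Finset.card_pos.mp (by omega)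
    have hSn : S.Nonempty := Finset.card_pos.mp (by omega)
    obtain ⟨t0, ht0⟩ := hTn
    obtain ⟨s0, hs0⟩ := hSn
    have hT' : T ⊆ Finset.univ.map F := by
      intro t ht
      obtain ⟨⟨a, b⟩, -, hab⟩ := Finset.mem_map.mp (h t ht s0 hs0)
      exact Finset.mem_map.mpr ⟨a, Finset.mem_univ _, congrArg Prod.fst hab⟩
    have hS' : S ⊆ Finset.univ.map G := by
      intro s hs
      obtain ⟨⟨a, b⟩, -, hab⟩ := Finset.mem_map.mp (h t0 ht0 s hs)
      exact Finset.mem_map.mpr ⟨b, Finset.mem_univ _, congrArg Prod.snd hab⟩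
    obtain ⟨T', -, rfl⟩ := Finset.subset_map_iff.mp hT'
    obtain ⟨S', -, rfl⟩ := Finset.subset_map_iff.mp hS'
    rw [Finset.card_map] at hT hS
    refine hE T' S' hT hS ?_
    intro t ht s hs
    have := h (F t) (Finset.mem_map_of_mem _ ht) (G s) (Finset.mem_map_of_mem _ hs)
    obtain ⟨⟨a, b⟩, hab, hab'⟩ := Finset.mem_map.mp this
    have e1 : a = t := F.injective (congrArg Prod.fst hab')
    have e2 : b = s := G.injective (congrArg Prod.snd hab')
    rw [← e1, ← e2]; exact hab
  · rwa [Finset.card_map]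

lemma three_dvd_count (S : Finset ℕ) (p x : ℕ) (hp : p.Prime) (hx : 0 < x)
    (h0 : ∀ s ∈ S, s ≠ 0) (h : ∏ s ∈ S, s = x ^ 3) (hsq : ∀ s ∈ S, ¬ p ^ 2 ∣ s) :
    3 ∣ (S.filter (fun s => p ∣ s)).card := by
  have h1 := congrArg (fun m => m.factorization p) h
  simp only [Nat.factorization_pow, Finsupp.smul_apply, smul_eq_mul] at h1
  rw [Nat.factorization_prod h0, Finset.sum_apply'] at h1
  have h2 : ∑ s ∈ S, s.factorization p = (S.filter (fun s => p ∣ s)).card := by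
    rw [Finset.card_filter]
    refine Finset.sum_congr rfl fun s hs => ?_
    split_ifs with hd
    · have a1 := (hp.dvd_iff_one_le_factorization (h0 s hs)).mp hd
      have a2 : ¬ 2 ≤ s.factorization p := fun h =>
        hsq s hs ((hp.pow_dvd_iff_le_factorization (h0 s hs)).mpr h)
      omega
    · exact Nat.factorization_eq_zero_of_not_dvd hd
  rw [← h2]
  exact ⟨_, h1⟩

lemma Fkd_ge (k d n : ℕ) (A : Finset ℕ) (hA : A ⊆ Finset.Icc 1 n)
    (h : ∀ S ⊆ A, S.card = k → ∀ x, 0 < x → ∏ s ∈ S, s ≠ x ^ d) : A.card ≤ Fkd k d n := by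
  classical
  apply le_csSup
  · refine ⟨n, ?_⟩
    rintro m ⟨B, hB, rfl, -⟩
    simpa using Finset.card_le_card hB
  · refine ⟨A, hA, rfl, ?_⟩
    intro a x ha hm hx
    have := h (Finset.univ.image a) (by
      intro s hs
      obtain ⟨i, -, rfl⟩ := Finset.mem_image.mp hs
      exact ha i) (by rw [Finset.card_image_of_injective _ hm.injective]; simp) x hx
    rwa [Finset.prod_image (fun i _ j _ hij => hm.injective hij)] at this

lemma Fkd_le (k d n B : ℕ) (h : ∀ A : Finset ℕ, A ⊆ Finset.Icc 1 n →
    (∀ S ⊆ A, S.card = k → ∀ x, 0 < x → ∏ s ∈ S, s ≠ x ^ d) → A.card ≤ B) (hk : 0 < k) :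
    Fkd k d n ≤ B := by
  classical
  apply csSup_le
  · refine ⟨0, ∅, by simp, by simp, ?_⟩
    intro a x ha
    exact absurd (ha ⟨0, hk⟩) (by simp)
  · rintro m ⟨A, hA, rfl, hA2⟩
    refine h A hA ?_
    intro S hS hc x hx
    have := hA2 (S.orderEmbOfFin hc) x (fun i => hS (Finset.orderEmbOfFin_mem _ _ _))
      (S.orderEmbOfFin hc).strictMono hx
    have h2 : ∏ s ∈ S, s = ∏ i, S.orderEmbOfFin hc i := by
      conv_lhs => rw [← Finset.image_orderEmbOfFin_univ S hc]
      rw [Finset.prod_image (fun i _ j _ hij => (S.orderEmbOfFin hc).injective hij)]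
    rwa [h2]

lemma k33_of_div (G : Finset (ℕ × ℕ)) (hc : G.card = 9)
    (h1 : ∀ u, 3 ∣ (G.filter (fun e => e.1 = u)).card)
    (h2 : ∀ v, 3 ∣ (G.filter (fun e => e.2 = v)).card) :
    ∃ T S : Finset ℕ, T.card = 3 ∧ S.card = 3 ∧ ∀ t ∈ T, ∀ s ∈ S, (t, s) ∈ G := by
  classical
  have a1 : (G.image Prod.fst).card ≤ 3 := by
    have := Finset.card_nsmul_le_sum (G.image Prod.fst)
      (fun u => (G.filter (fun e => e.1 = u)).card) 3 (by
        intro u hu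
        obtain ⟨e, he, rfl⟩ := Finset.mem_image.mp hu
        refine Nat.le_of_dvd (Finset.card_pos.mpr ⟨e, by simp [he]⟩) (h1 _))
    rw [← Finset.card_eq_sum_card_image, hc] at this
    simp at this; omega
  have a2 : (G.image Prod.snd).card ≤ 3 := by
    have := Finset.card_nsmul_le_sum (G.image Prod.snd)
      (fun u => (G.filter (fun e => e.2 = u)).card) 3 (by
        intro u hu
        obtain ⟨e, he, rfl⟩ := Finset.mem_image.mp hu
        refine Nat.le_of_dvd (Finset.card_pos.mpr ⟨e, by simp [he]⟩) (h2 _))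
    rw [← Finset.card_eq_sum_card_image, hc] at this
    simp at this; omega
  have hsub : G ⊆ (G.image Prod.fst) ×ˢ (G.image Prod.snd) := by
    intro e he
    exact Finset.mem_product.mpr ⟨Finset.mem_image_of_mem _ he, Finset.mem_image_of_mem _ he⟩
  have a3 := Finset.card_le_card hsub
  rw [Finset.card_product, hc] at a3
  have b1 : (G.image Prod.fst).card = 3 := by nlinarith
  have b2 : (G.image Prod.snd).card = 3 := by nlinarith
  refine ⟨_, _, b1, b2, ?_⟩
  have := Finset.eq_of_subset_of_card_le hsub (by rw [Finset.card_product, b1, b2, hc])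
  intro t ht s hs
  rw [this]
  exact Finset.mem_product.mpr ⟨ht, hs⟩

lemma lower_struct (n s : ℕ) (hs : 2 ≤ s) (hsn : s * s ≤ n) (P1 P2 : Finset ℕ)
    (hd : Disjoint P1 P2) (h1 : ∀ p ∈ P1, p.Prime ∧ p ≤ s) (h2 : ∀ p ∈ P2, p.Prime ∧ p ≤ s)
    (E : Finset (ℕ × ℕ)) (hE : E ⊆ P1 ×ˢ P2) (hK : K33Free E) :
    Nat.primeCounting n + Nat.primeCounting (n / 2) + E.card ≤
      Fkd 9 3 n + 2 * Nat.primeCounting s := by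
  classical
  have hne : ∀ p ∈ P1, ∀ q ∈ P2, p ≠ q := fun p hp q hq h =>
    Finset.disjoint_left.mp hd hp (h ▸ hq)
  have hE1 : ∀ e ∈ E, e.1 ∈ P1 ∧ e.2 ∈ P2 := fun e he => Finset.mem_product.mp (hE he)
  have hdvd1 : ∀ e ∈ E, ∀ p, p.Prime → p ∣ e.1 * e.2 → p = e.1 ∨ p = e.2 := by
    intro e he p hp hpd
    obtain ⟨a, b⟩ := hE1 e he
    rcases hp.dvd_mul.mp hpd with h | h
    · exact Or.inl ((Nat.prime_dvd_prime_iff_eq hp (h1 _ a).1).mp h)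
    · exact Or.inr ((Nat.prime_dvd_prime_iff_eq hp (h2 _ b).1).mp h)
  let L1 := (Nat.primesLE n).filter (fun p => s < p)
  let L2 := ((Nat.primesLE (n / 2)).filter (fun p => s < p)).image (fun p => 2 * p)
  let A3 := E.image (fun e => e.1 * e.2)
  have hL1 : ∀ a ∈ L1, a.Prime ∧ a ≤ n ∧ s < a := by
    intro a ha
    simp only [L1, Finset.mem_filter, Nat.mem_primesLE] at ha
    tauto
  have hL2 : ∀ a ∈ L2, ∃ p, p.Prime ∧ p ≤ n / 2 ∧ s < p ∧ a = 2 * p := by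
    intro a ha
    simp only [L2, Finset.mem_image, Finset.mem_filter, Nat.mem_primesLE] at ha
    obtain ⟨p, hp, rfl⟩ := ha
    exact ⟨p, by tauto⟩
  have hA3 : ∀ a ∈ A3, ∃ e ∈ E, a = e.1 * e.2 := by
    intro a ha
    obtain ⟨e, he, rfl⟩ := Finset.mem_image.mp ha
    exact ⟨e, he, rfl⟩
  have hbig : ∀ a ∈ A3, ∀ p, p.Prime → s < p → ¬ p ∣ a := by
    intro a ha p hp hsp hpa
    obtain ⟨e, he, rfl⟩ := hA3 a ha
    have := h1 _ (hE1 e he).1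
    have := h2 _ (hE1 e he).2
    rcases hdvd1 e he p hp hpa with h | h <;> omega
  have hinj : Set.InjOn (fun e : ℕ × ℕ => e.1 * e.2) (E : Set (ℕ × ℕ)) := by
    rintro ⟨a, b⟩ he ⟨c, d⟩ hf hef
    simp only at hef
    have he' := hE1 _ he
    have hf' := hE1 _ hf
    simp only at he' hf'
    have e1 : a = c := by
      rcases hdvd1 _ hf a (h1 _ he'.1).1 ⟨b, hef.symm⟩ with h | h
      · exact h
      · exact absurd h (hne _ he'.1 _ hf'.2)
    subst e1
    rw [Nat.eq_of_mul_eq_mul_left (h1 _ he'.1).1.pos hef]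
  have hcard : Nat.primeCounting n + Nat.primeCounting (n / 2) + E.card ≤
      (L1 ∪ L2 ∪ A3).card + 2 * Nat.primeCounting s := by
    have c1 : Nat.primeCounting n ≤ L1.card + Nat.primeCounting s := by
      rw [← Nat.primesLE_card_eq_primeCounting, ← Nat.primesLE_card_eq_primeCounting]
      refine le_trans (Finset.card_le_card ?_) (Finset.card_union_le _ _)
      intro p hp
      simp only [L1, Finset.mem_union, Finset.mem_filter, Nat.mem_primesLE] at *
      rcases lt_or_ge s p with h | h <;> tauto
    have c2 : Nat.primeCounting (n / 2) ≤ L2.card + Nat.primeCounting s := by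
      rw [Finset.card_image_of_injective _ (fun a b h => by simpa using h)]
      rw [← Nat.primesLE_card_eq_primeCounting, ← Nat.primesLE_card_eq_primeCounting]
      refine le_trans (Finset.card_le_card ?_) (Finset.card_union_le _ _)
      intro p hp
      simp only [Finset.mem_union, Finset.mem_filter, Nat.mem_primesLE] at *
      rcases lt_or_ge s p with h | h <;> tauto
    have c3 : A3.card = E.card := Finset.card_image_of_injOn hinj
    have d1 : Disjoint L1 L2 := by
      rw [Finset.disjoint_left]
      intro a ha hb
      obtain ⟨p, hp, -, hsp, rfl⟩ := hL2 a hb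
      exact Nat.not_prime_mul (by norm_num) hp.ne_one (hL1 _ ha).1
    have d2 : Disjoint (L1 ∪ L2) A3 := by
      rw [Finset.disjoint_left]
      intro a ha hb
      rcases Finset.mem_union.mp ha with ha | ha
      · exact hbig a hb a (hL1 a ha).1 (hL1 a ha).2.2 dvd_rfl
      · obtain ⟨p, hp, -, hsp, rfl⟩ := hL2 a ha
        exact hbig _ hb p hp hsp (Dvd.intro_left _ rfl)
    rw [Finset.card_union_of_disjoint d2, Finset.card_union_of_disjoint d1]
    omega
  refine hcard.trans (Nat.add_le_add_right (Fkd_ge 9 3 n _ ?_ ?_) _)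
  · intro a ha
    rw [Finset.mem_Icc]
    rcases Finset.mem_union.mp ha with ha | ha
    · rcases Finset.mem_union.mp ha with ha | ha
      · exact ⟨(hL1 a ha).1.pos, (hL1 a ha).2.1⟩
      · obtain ⟨p, hp, hpn, hsp, rfl⟩ := hL2 a ha
        omega
    · obtain ⟨e, he, rfl⟩ := hA3 a ha
      have a1 := h1 _ (hE1 e he).1
      have a2 := h2 _ (hE1 e he).2
      exact ⟨Nat.mul_pos a1.1.pos a2.1.pos, (Nat.mul_le_mul a1.2 a2.2).trans hsn⟩
  · intro S hS hSc x hx hprod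
    have key : ∀ p, p.Prime → s < p → ∀ a ∈ L1 ∪ L2 ∪ A3, p ∣ a → a = p ∨ a = 2 * p := by
      intro p hp hsp a ha hpa
      rcases Finset.mem_union.mp ha with ha | ha
      · rcases Finset.mem_union.mp ha with ha | ha
        · exact Or.inl ((Nat.prime_dvd_prime_iff_eq hp (hL1 a ha).1).mp hpa).symm
        · obtain ⟨p', hp', hpn, hsp', rfl⟩ := hL2 a ha
          rcases hp.dvd_mul.mp hpa with h | h
          · have := Nat.le_of_dvd (by norm_num) h
            omega
          · right; rw [(Nat.prime_dvd_prime_iff_eq hp hp').mp h]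
      · exact absurd hpa (hbig a ha p hp hsp)
    have hpos : ∀ a ∈ L1 ∪ L2 ∪ A3, a ≠ 0 := by
      intro a ha
      rcases Finset.mem_union.mp ha with ha | ha
      · rcases Finset.mem_union.mp ha with ha | ha
        · exact (hL1 a ha).1.ne_zero
        · obtain ⟨p, hp, hpn, hsp, rfl⟩ := hL2 a ha
          omega
      · obtain ⟨e, he, rfl⟩ := hA3 a ha
        exact (Nat.mul_pos (h1 _ (hE1 e he).1).1.pos (h2 _ (hE1 e he).2).1.pos).ne'
    have hnone : ∀ p, p.Prime → s < p → ∀ a ∈ S, ¬ p ∣ a := by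
      intro p hp hsp a ha hpa
      have hdv := three_dvd_count S p x hp hx (fun a ha => hpos a (hS ha)) hprod (by
        intro b hb hpb
        have hp2 : 2 < p := by omega
        rcases key p hp hsp b (hS hb) (dvd_trans (dvd_pow_self p (by norm_num)) hpb) with h | h
        · have := Nat.le_of_dvd (by omega) hpb
          nlinarith
        · have := Nat.le_of_dvd (by omega) hpb
          nlinarith)
      have hle : (S.filter (fun a => p ∣ a)).card ≤ 2 := by
        refine (Finset.card_le_card (t := {p, 2 * p}) ?_).trans Finset.card_le_two
        intro b hb
        rw [Finset.mem_filter] at hb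
        simpa using key p hp hsp b (hS hb.1) hb.2
      have hpo : 0 < (S.filter (fun a => p ∣ a)).card :=
        Finset.card_pos.mpr ⟨a, Finset.mem_filter.mpr ⟨ha, hpa⟩⟩
      have := Nat.le_of_dvd hpo hdv
      omega
    have hSA : S ⊆ A3 := by
      intro a ha
      rcases Finset.mem_union.mp (hS ha) with hb | hb
      · rcases Finset.mem_union.mp hb with hb | hb
        · exact absurd dvd_rfl (hnone a (hL1 a hb).1 (hL1 a hb).2.2 a ha)
        · obtain ⟨p, hp, hpn, hsp, rfl⟩ := hL2 a hb
          exact absurd (Dvd.intro_left _ rfl) (hnone p hp hsp _ ha)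
      · exact hb
    obtain ⟨G, hGE, rfl⟩ := Finset.subset_image_iff.mp hSA
    have hGE' : G ⊆ E := by exact_mod_cast hGE
    have hinjG : Set.InjOn (fun e : ℕ × ℕ => e.1 * e.2) (G : Set (ℕ × ℕ)) := hinj.mono hGE
    rw [Finset.card_image_of_injOn hinjG] at hSc
    have hsqf : ∀ p, p.Prime → ∀ a ∈ G.image (fun e => e.1 * e.2), ¬ p ^ 2 ∣ a := by
      intro p hp a ha hpa
      obtain ⟨e, he, rfl⟩ := Finset.mem_image.mp ha
      have q1 := h1 _ (hE1 e (hGE' he)).1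
      have q2 := h2 _ (hE1 e (hGE' he)).2
      have hnn := hne _ (hE1 e (hGE' he)).1 _ (hE1 e (hGE' he)).2
      rw [pow_two] at hpa
      rcases hdvd1 e (hGE' he) p hp (dvd_trans (dvd_mul_right p p) hpa) with h | h
      · rw [h] at hpa
        exact hnn ((Nat.prime_dvd_prime_iff_eq q1.1 q2.1).mp (Nat.dvd_of_mul_dvd_mul_left q1.1.pos hpa))
      · rw [h] at hpa
        exact hnn ((Nat.prime_dvd_prime_iff_eq q2.1 q1.1).mp
          (Nat.dvd_of_mul_dvd_mul_right q2.1.pos hpa)).symm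
    have hcount : ∀ p, p.Prime → 3 ∣ (G.filter (fun e => p ∣ e.1 * e.2)).card := by
      intro p hp
      have := three_dvd_count _ p x hp hx (fun a ha => hpos a (hS ha)) hprod (hsqf p hp)
      rwa [Finset.filter_image, Finset.card_image_of_injOn
        (hinjG.mono (by intro e he; simp at he ⊢; exact he.1))] at this
    obtain ⟨T, S', hT, hS', hTS⟩ := k33_of_div G hSc (by
      intro u
      by_cases hu : u ∈ P1
      · have := hcount u (h1 u hu).1
        convert this using 2
        refine Finset.filter_congr fun e he => ?_
        constructor
        · rintro rfl; exact dvd_mul_right _ _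
        · intro h
          rcases hdvd1 e (hGE' he) u (h1 u hu).1 h with h | h
          · exact h.symm
          · exact absurd h (hne _ hu _ (hE1 e (hGE' he)).2)
      · rw [Finset.filter_false_of_mem]
        · simp
        · rintro e he rfl; exact hu (hE1 e (hGE' he)).1) (by
      intro u
      by_cases hu : u ∈ P2
      · have := hcount u (h2 u hu).1
        convert this using 2
        refine Finset.filter_congr fun e he => ?_
        constructor
        · rintro rfl; exact dvd_mul_left _ _
        · intro h
          rcases hdvd1 e (hGE' he) u (h2 u hu).1 h with h | h
          · exact absurd h.symm (hne _ (hE1 e (hGE' he)).1 _ hu)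
          · exact h.symm
      · rw [Finset.filter_false_of_mem]
        · simp
        · rintro e he rfl; exact hu (hE1 e (hGE' he)).2)
    exact hK T S' hT hS' fun t ht s hs => hGE' (hTS t ht s hs)


lemma pi_lower (s : ℕ) (hs : 100 ≤ s) : (s : ℝ) / 2 ≤ Nat.primeCounting s * Real.log s := by
  have hs' : (100 : ℝ) ≤ s := by exact_mod_cast hs
  have h := Chebyshev.pi_ge s
  have hl : 0 < Real.log s := Real.log_pos (by linarith)
  rw [div_le_iff₀ hl] at h
  refine le_trans ?_ h
  have h1 : Real.log (s + 1) ≤ s / 20 + 5 * Real.log 2 := by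
    have e : ((s : ℝ) + 1) = ((s + 1) / 32) * 2 ^ 5 := by ring
    rw [e, Real.log_mul (by positivity) (by norm_num), Real.log_pow]
    have := Real.log_le_sub_one_of_pos (show (0 : ℝ) < (s + 1) / 32 by positivity)
    push_cast
    linarith
  have h2 := Real.log_two_gt_d9
  have h3 := Real.log_two_lt_d9
  nlinarith

lemma lower_bound : ∃ c1 : ℝ, 0 < c1 ∧ ∀ᶠ n : ℕ in Filter.atTop,
    (Nat.primeCounting n : ℝ) + (Nat.primeCounting (n / 2) : ℝ)
        + c1 * (n : ℝ) ^ ((5 : ℝ)/6) / (Real.log n) ^ ((5 : ℝ)/3)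
        ≤ (Fkd 9 3 n : ℝ) := by
  classical
  obtain ⟨c1, hc1⟩ : ∃ c1 : ℝ, c1 = (1 / 256 : ℝ) ^ ((5 : ℝ) / 3) / 4 := ⟨_, rfl⟩
  have hc1p : 0 < c1 := by rw [hc1]; positivity
  refine ⟨c1, hc1p, ?_⟩
  have ev1 := ((isLittleO_log_rpow_atTop (show (0 : ℝ) < 1 / 2 by norm_num)).bound
    (show (0 : ℝ) < 1 / 2048 by norm_num))
  have ev2 := ((isLittleO_log_rpow_rpow_atTop (5 / 3) (show (0 : ℝ) < 1 / 3 by norm_num)).bound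
    (show (0 : ℝ) < c1 / 2 by positivity))
  filter_upwards [tendsto_natCast_atTop_atTop.eventually ev1,
    tendsto_natCast_atTop_atTop.eventually ev2, eventually_ge_atTop 3] with n hn1 hn2 hn3
  have hn0 : (0 : ℝ) < n := by positivity
  have hn3' : (3 : ℝ) ≤ n := by exact_mod_cast hn3
  have hL1 : 1 ≤ Real.log n := by
    rw [Real.le_log_iff_exp_le hn0]
    have := Real.exp_one_lt_d9
    linarith
  obtain ⟨L, hL⟩ : ∃ L, L = Real.log n := ⟨_, rfl⟩
  rw [← hL] at hL1 hn1 hn2 ⊢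
  have hL0 : 0 < L := by linarith
  obtain ⟨R, hR⟩ : ∃ R : ℝ, R = (n : ℝ) ^ (1 / 2 : ℝ) := ⟨_, rfl⟩
  have hR0 : 0 < R := by rw [hR]; positivity
  rw [Real.norm_of_nonneg (by positivity), Real.norm_of_nonneg (by positivity)] at hn1 hn2
  rw [← hR] at hn1
  have hRL : 2048 * L ≤ R := by linarith
  have hRn : R * R = n := by
    rw [hR, ← Real.rpow_add hn0]; norm_num
  obtain ⟨s, hs⟩ : ∃ s, s = Nat.sqrt n := ⟨_, rfl⟩
  have hs1 : s * s ≤ n := by rw [hs]; exact Nat.sqrt_le n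
  have hs2 : n < (s + 1) * (s + 1) := by rw [hs]; exact Nat.lt_succ_sqrt n
  have hs1' : (s : ℝ) ≤ R := by
    have : (s : ℝ) * s ≤ n := by exact_mod_cast hs1
    by_contra h
    push Not at h
    nlinarith
  have hs2' : R ≤ (s : ℝ) + 1 := by
    have : (n : ℝ) < ((s : ℝ) + 1) * (s + 1) := by exact_mod_cast hs2
    by_contra h
    push Not at h
    nlinarith
  have hsbig : 100 ≤ s := by
    have : (100 : ℝ) ≤ s := by linarith
    exact_mod_cast this
  have hM := pi_lower s hsbig
  have hsn : s ≤ n := le_trans (Nat.le_mul_self s) hs1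
  have hlogs : Real.log s ≤ L := by
    rw [hL]
    apply Real.log_le_log
    · have : (100 : ℝ) ≤ s := by exact_mod_cast hsbig
      linarith
    · exact_mod_cast hsn
  obtain ⟨M, hMdef⟩ : ∃ M, M = Nat.primeCounting s := ⟨_, rfl⟩
  rw [← hMdef] at hM
  have hM2 : R / 4 ≤ M * L := by
    have : (M : ℝ) * Real.log s ≤ M * L := by gcongr
    linarith
  -- y
  obtain ⟨y, hy⟩ : ∃ y : ℝ, y = (R / (256 * L)) ^ (1 / 3 : ℝ) := ⟨_, rfl⟩
  have hyp : 0 < y := by rw [hy]; positivity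
  have hy3 : y ^ 3 = R / (256 * L) := by
    rw [hy, ← Real.rpow_natCast, ← Real.rpow_mul (by positivity)]; norm_num
  have hy2 : 2 ≤ y := by
    have : (2 : ℝ) ^ 3 ≤ y ^ 3 := by
      rw [hy3, le_div_iff₀ (by positivity)]; linarith
    exact le_of_pow_le_pow_left₀ (by norm_num) hyp.le this
  obtain ⟨q, hq, hq1, hq2⟩ := Nat.exists_prime_lt_and_le_two_mul ⌊y⌋₊
    (by have := Nat.le_floor (show ((2 : ℕ) : ℝ) ≤ y by exact_mod_cast hy2); omega)
  have hfl2 : 2 ≤ ⌊y⌋₊ := Nat.le_floor (by exact_mod_cast hy2)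
  have hqy : y < q := by
    have := Nat.lt_floor_add_one y
    have h2 : ((⌊y⌋₊ : ℝ)) + 1 ≤ q := by exact_mod_cast hq1
    linarith
  have hqy2 : (q : ℝ) ≤ 2 * y := by
    have := Nat.floor_le hyp.le
    have h2 : (q : ℝ) ≤ 2 * (⌊y⌋₊ : ℝ) := by exact_mod_cast hq2
    linarith
  have hq3 : 2 * q ^ 3 ≤ M := by
    have h1 : (q : ℝ) ^ 3 ≤ (2 * y) ^ 3 := by gcongr
    have h2 : (2 * y) ^ 3 = R / L / 32 := by rw [mul_pow, hy3]; field_simp; norm_num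
    have h3 : R / L / 4 ≤ M := by
      rw [div_div, div_le_iff₀ (by positivity)]; linarith
    have h4 : 0 < R / L := by positivity
    have : (2 : ℝ) * (q : ℝ) ^ 3 ≤ M := by rw [h2] at h1; linarith
    exact_mod_cast this
  -- split the primes
  have hcardP : (Nat.primesLE s).card = M := by rw [hMdef]; exact Nat.primesLE_card_eq_primeCounting s
  obtain ⟨P1, hP1, hP1c⟩ := Finset.exists_subset_card_eq (s := Nat.primesLE s) (n := q ^ 3)
    (by omega)
  obtain ⟨E, hE, hK, hEc⟩ := brown_transfer q hq (by omega) P1 (Nat.primesLE s \ P1)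
    (by omega) (by rw [Finset.card_sdiff_of_subset hP1]; omega)
  have main := lower_struct n s (by omega) hs1 P1 (Nat.primesLE s \ P1) Finset.disjoint_sdiff
    (fun p hp => by have := Nat.mem_primesLE.mp (hP1 hp); tauto)
    (fun p hp => by have := Nat.mem_primesLE.mp (Finset.sdiff_subset hp); tauto) E hE hK
  have main' : (Nat.primeCounting n : ℝ) + Nat.primeCounting (n / 2) + E.card ≤
      Fkd 9 3 n + 2 * Nat.primeCounting s := by exact_mod_cast main
  have hpis : (Nat.primeCounting s : ℝ) ≤ R := by
    refine le_trans ?_ hs1'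
    have : Nat.primeCounting s ≤ s := by
      rw [← Nat.primesLE_card_eq_primeCounting]
      refine (Finset.card_le_card (t := Finset.Icc 1 s) ?_).trans (by simp)
      intro p hp
      have := Nat.mem_primesLE.mp hp
      rw [Finset.mem_Icc]
      exact ⟨this.2.pos, this.1⟩
    exact_mod_cast this
  obtain ⟨X, hX⟩ : ∃ X : ℝ, X = (n : ℝ) ^ ((5 : ℝ)/6) / L ^ ((5 : ℝ)/3) := ⟨_, rfl⟩
  have hEX : 2 * c1 * X ≤ E.card := by
    have h1 : (q : ℝ) ^ 4 * ((q : ℝ) - 1) ≤ E.card := by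
      have : ((q ^ 4 * (q - 1) : ℕ) : ℝ) ≤ E.card := by exact_mod_cast hEc
      rwa [Nat.cast_mul, Nat.cast_sub hq.one_le, Nat.cast_pow, Nat.cast_one] at this
    have h2 : (q : ℝ) ^ 5 / 2 ≤ (q : ℝ) ^ 4 * ((q : ℝ) - 1) := by
      have : (2 : ℝ) ≤ q := by linarith
      have h4 : (0 : ℝ) < (q : ℝ) ^ 4 := by positivity
      have h5 := mul_le_mul_of_nonneg_left this h4.le
      have h6 : (q : ℝ) ^ 5 = (q : ℝ) ^ 4 * q := by ring
      rw [h6]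
      linarith
    have h3 : y ^ 5 ≤ (q : ℝ) ^ 5 := by gcongr
    have h4 : y ^ 5 = (1 / 256 : ℝ) ^ ((5 : ℝ) / 3) * X := by
      rw [hy, ← Real.rpow_natCast, ← Real.rpow_mul (by positivity), hX, hR]
      rw [show (n : ℝ) ^ (1 / 2 : ℝ) / (256 * L) = (1 / 256) * ((n : ℝ) ^ (1 / 2 : ℝ) / L) by
        field_simp]
      rw [Real.mul_rpow (by norm_num) (by positivity), Real.div_rpow (by positivity) hL0.le,
        ← Real.rpow_mul hn0.le]
      norm_num
    rw [hc1]
    linarith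
  have hRX : 2 * R ≤ c1 * X := by
    have : R * (n : ℝ) ^ (1 / 3 : ℝ) = (n : ℝ) ^ ((5 : ℝ) / 6) := by
      rw [hR, ← Real.rpow_add hn0]; norm_num
    rw [hX, ← this, mul_div_assoc', le_div_iff₀ (by positivity)]
    have := mul_le_mul_of_nonneg_left hn2 hR0.le
    linarith
  have : c1 * (n : ℝ) ^ ((5 : ℝ)/6) / L ^ ((5 : ℝ)/3) = c1 * X := by rw [hX]; ring
  rw [this]
  linarith


lemma rep_lemma (A Ai : Finset ℕ) (hA0 : 0 ∉ A) (hAi : Ai ⊆ A)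
    (hA : ∀ S ⊆ A, S.card = 9 → ∀ x, 0 < x → ∏ s ∈ S, s ≠ x ^ 3)
    (P : ℕ × ℕ → Prop) (h : ∀ a ∈ Ai, ∃ e : ℕ × ℕ, P e ∧ e.1 * e.2 = a) :
    ∃ E : Finset (ℕ × ℕ), K33Free E ∧ E.card = Ai.card ∧ ∀ e ∈ E, P e ∧ e.1 * e.2 ∈ A := by
  classical
  choose! f hf using h
  have hE : ∀ e ∈ Ai.image f, P e ∧ e.1 * e.2 ∈ Ai ∧ f (e.1 * e.2) = e := by
    intro e he
    obtain ⟨a, ha, rfl⟩ := Finset.mem_image.mp he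
    rw [(hf a ha).2]
    exact ⟨(hf a ha).1, ha, rfl⟩
  refine ⟨Ai.image f, ?_, ?_, fun e he => ⟨(hE e he).1, hAi (hE e he).2.1⟩⟩
  · intro T S hT hS hTS
    have hmem : ∀ e ∈ T ×ˢ S, e ∈ Ai.image f := by
      intro e he
      rw [Finset.mem_product] at he
      exact hTS _ he.1 _ he.2
    have hinj : Set.InjOn (fun e : ℕ × ℕ => e.1 * e.2) ((T ×ˢ S : Finset (ℕ × ℕ)) : Set (ℕ × ℕ)) := by
      intro e he e' he' hee
      rw [← (hE e (hmem e he)).2.2, ← (hE e' (hmem e' he')).2.2]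
      exact congrArg f hee
    have hne : ∀ e ∈ T ×ˢ S, e.1 * e.2 ≠ 0 := fun e he h0 =>
      hA0 (h0 ▸ hAi (hE e (hmem e he)).2.1)
    obtain ⟨t0, ht0⟩ : T.Nonempty := Finset.card_pos.mp (by omega)
    obtain ⟨s0, hs0⟩ : S.Nonempty := Finset.card_pos.mp (by omega)
    refine hA ((T ×ˢ S).image (fun e => e.1 * e.2)) ?_ ?_ ((∏ t ∈ T, t) * ∏ s ∈ S, s) ?_ ?_
    · intro a ha
      obtain ⟨e, he, rfl⟩ := Finset.mem_image.mp ha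
      exact hAi (hE e (hmem e he)).2.1
    · rw [Finset.card_image_of_injOn hinj, Finset.card_product, hT, hS]
    · apply Nat.mul_pos
      · refine Finset.prod_pos fun t ht => Nat.pos_of_ne_zero fun h0 => ?_
        exact hne (t, s0) (Finset.mem_product.mpr ⟨ht, hs0⟩) (by simp [h0])
      · refine Finset.prod_pos fun t ht => Nat.pos_of_ne_zero fun h0 => ?_
        exact hne (t0, t) (Finset.mem_product.mpr ⟨ht0, ht⟩) (by simp [h0])
    · rw [Finset.prod_image hinj, Finset.prod_product]
      have e1 : ∀ t ∈ T, ∏ s ∈ S, t * s = t ^ 3 * ∏ s ∈ S, s := by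
        intro t _
        rw [Finset.prod_mul_distrib, Finset.prod_const, hS]
      refine (Finset.prod_congr rfl e1).trans ?_
      rw [Finset.prod_mul_distrib, Finset.prod_const, hT, Finset.prod_pow]
      ring
  · refine Finset.card_image_of_injOn ?_
    intro a ha b hb hab
    rw [← (hf a ha).2, ← (hf b hb).2, hab]

lemma six_choose (m : ℕ) : 6 * (m + 2).choose 3 = (m + 2) * (m + 1) * m := by
  have := Nat.descFactorial_eq_factorial_mul_choose (m + 2) 3
  rw [show Nat.factorial 3 = 6 from rfl] at this
  rw [← this]
  simp [Nat.descFactorial]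
  ring

lemma deg_ineq (d : ℕ) (l : ℝ) (hl : 0 < l) :
    (d : ℝ) ≤ 2 + l + 6 * (1 / l ^ 2 * (d.choose 3 : ℝ)) := by
  have hnn : 0 ≤ 6 * (1 / l ^ 2 * (d.choose 3 : ℝ)) := by positivity
  rcases lt_or_ge d 2 with h | h
  · have : (d : ℝ) ≤ 2 := by exact_mod_cast h.le
    linarith
  · obtain ⟨m, rfl⟩ := Nat.exists_eq_add_of_le' h
    have h6 : (6 : ℝ) * ((m + 2).choose 3 : ℝ) = (m + 2) * (m + 1) * m := by
      exact_mod_cast six_choose m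
    push_cast
    rcases le_or_gt (m : ℝ) l with hm | hm
    · linarith
    · have e : 6 * (1 / l ^ 2 * ((m + 2).choose 3 : ℝ)) = (m + 2) * (m + 1) * m / l ^ 2 := by
        rw [← h6]; ring
      rw [e]
      have : (m : ℝ) ≤ (m + 2) * (m + 1) * m / l ^ 2 := by
        rw [le_div_iff₀ (by positivity)]
        have : l ^ 2 ≤ (m + 2) * (m + 1) := by nlinarith
        nlinarith
      linarith

lemma deg_ineq' (d : ℕ) : d ≤ 2 + d.choose 3 := by
  rcases lt_or_ge d 2 with h | h
  · omega
  · obtain ⟨m, rfl⟩ := Nat.exists_eq_add_of_le' h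
    have h6 := six_choose m
    nlinarith [Nat.zero_le (m * m), Nat.zero_le (m * m * m), mul_nonneg (Nat.zero_le m) (Nat.zero_le m), Nat.le_mul_self m, Nat.mul_le_mul_right m (Nat.le_mul_self m)]

lemma sup_count (B u : ℕ) :
    2 * (((Finset.Icc 1 B).powersetCard 3).filter (fun T => T.sup id = u)).card ≤ u ^ 2 := by
  classical
  have hmem : ∀ T ∈ ((Finset.Icc 1 B).powersetCard 3).filter (fun T => T.sup id = u),
      T ⊆ Finset.Icc 1 B ∧ T.card = 3 ∧ u ∈ T ∧ ∀ t ∈ T, t ≤ u := by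
    intro T hT
    rw [Finset.mem_filter, Finset.mem_powersetCard] at hT
    obtain ⟨⟨h1, h2⟩, rfl⟩ := hT
    have hne : T.Nonempty := Finset.card_pos.mp (by omega)
    refine ⟨h1, h2, ?_, fun t ht => Finset.le_sup (f := id) ht⟩
    obtain ⟨t, ht, hh⟩ := Finset.exists_mem_eq_sup T hne id
    rw [hh]; exact ht
  have h1 : (((Finset.Icc 1 B).powersetCard 3).filter (fun T => T.sup id = u)).card ≤
      ((Finset.Icc 1 (u - 1)).powersetCard 2).card := by
    refine Finset.card_le_card_of_injOn (fun T => T.erase u) ?_ ?_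
    · intro T hT
      obtain ⟨a, b, c, d⟩ := hmem T hT
      refine Finset.mem_coe.mpr (Finset.mem_powersetCard.mpr ⟨?_, ?_⟩)
      · intro t ht
        rw [Finset.mem_erase] at ht
        have := d t ht.2
        have := Finset.mem_Icc.mp (a ht.2)
        rw [Finset.mem_Icc]
        omega
      · rw [Finset.card_erase_of_mem c, b]
    · intro T hT T' hT' hTT
      obtain ⟨a, b, c, d⟩ := hmem T hT
      obtain ⟨a', b', c', d'⟩ := hmem T' hT'
      rw [← Finset.insert_erase c, ← Finset.insert_erase c']
      exact congrArg (insert u) hTT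
  rw [Finset.card_powersetCard, Nat.card_Icc, Nat.choose_two_right] at h1
  have h2 := Nat.mul_div_le ((u - 1 + 1 - 1) * (u - 1 + 1 - 1 - 1)) 2
  have h3 : (u - 1 + 1 - 1) * (u - 1 + 1 - 1 - 1) ≤ u * u := Nat.mul_le_mul (by omega) (by omega)
  rw [pow_two]
  omega

lemma kst (E : Finset (ℕ × ℕ)) (hK : K33Free E) (V : Finset ℕ) (B : ℕ) (w W : ℕ → ℝ)
    (hB : ∀ e ∈ E, 1 ≤ e.1 ∧ e.1 ≤ B) (hW : ∀ u, 0 ≤ W u)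
    (hwW : ∀ e ∈ E, w e.2 ≤ W e.1) :
    ∑ v ∈ V, w v * ((E.filter (fun e => e.2 = v)).card.choose 3 : ℝ) ≤
      ∑ u ∈ Finset.Icc 1 B, (u : ℝ) ^ 2 * W u := by
  classical
  let N : ℕ → Finset ℕ := fun v => (E.filter (fun e => e.2 = v)).image Prod.fst
  have hN : ∀ v u, u ∈ N v ↔ (u, v) ∈ E := by
    intro v u
    simp only [N, Finset.mem_image, Finset.mem_filter]
    constructor
    · rintro ⟨⟨a, b⟩, ⟨h1, h2⟩, h3⟩
      simp only at h2 h3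
      rw [← h2, ← h3]; exact h1
    · intro h
      exact ⟨(u, v), ⟨h, rfl⟩, rfl⟩
  have hNc : ∀ v, (N v).card = (E.filter (fun e => e.2 = v)).card := by
    intro v
    refine Finset.card_image_of_injOn ?_
    rintro ⟨a, b⟩ ha ⟨c, d⟩ hc hac
    simp only [Finset.coe_filter, Set.mem_ofPred_eq] at ha hc hac
    rw [hac, ha.2, hc.2]
  have hNB : ∀ v, N v ⊆ Finset.Icc 1 B := by
    intro v u hu
    rw [Finset.mem_Icc]
    exact hB _ ((hN v u).mp hu)
  let TT := (Finset.Icc 1 B).powersetCard 3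
  have e1 : ∀ v, w v * ((E.filter (fun e => e.2 = v)).card.choose 3 : ℝ) =
      ∑ T ∈ TT, if T ⊆ N v then w v else 0 := by
    intro v
    rw [← Finset.sum_filter, Finset.sum_const, nsmul_eq_mul, mul_comm, ← hNc,
      ← Finset.card_powersetCard]
    congr 3
    ext T
    simp only [TT, Finset.mem_powersetCard, Finset.mem_filter]
    constructor
    · rintro ⟨h1, h2⟩; exact ⟨⟨h1.trans (hNB v), h2⟩, h1⟩
    · rintro ⟨⟨h1, h2⟩, h3⟩; exact ⟨h3, h2⟩
  rw [Finset.sum_congr rfl (fun v _ => e1 v), Finset.sum_comm]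
  have e2 : ∀ T ∈ TT, (∑ v ∈ V, if T ⊆ N v then w v else 0) ≤ 2 * W (T.sup id) := by
    intro T hT
    rw [Finset.mem_powersetCard] at hT
    have hne : T.Nonempty := Finset.card_pos.mp (by omega)
    obtain ⟨t, ht, hh⟩ := Finset.exists_mem_eq_sup T hne id
    rw [← Finset.sum_filter, hh, id]
    have hc2 : (V.filter (fun v => T ⊆ N v)).card ≤ 2 := by
      by_contra hcon
      obtain ⟨S, hS, hSc⟩ := Finset.exists_subset_card_eq
        (s := V.filter (fun v => T ⊆ N v)) (n := 3) (by omega)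
      refine hK T S hT.2 hSc ?_
      intro t ht s hs
      exact (hN s t).mp ((Finset.mem_filter.mp (hS hs)).2 ht)
    have := Finset.sum_le_card_nsmul (V.filter (fun v => T ⊆ N v)) w (W t) (by
      intro v hv
      exact hwW (t, v) ((hN v t).mp ((Finset.mem_filter.mp hv).2 ht)))
    refine this.trans ?_
    rw [nsmul_eq_mul]
    have : ((V.filter (fun v => T ⊆ N v)).card : ℝ) ≤ 2 := by exact_mod_cast hc2
    exact mul_le_mul_of_nonneg_right this (hW t)
  refine (Finset.sum_le_sum e2).trans ?_
  have hmaps : ∀ T ∈ TT, T.sup id ∈ Finset.Icc 1 B := by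
    intro T hT
    rw [Finset.mem_powersetCard] at hT
    have hne : T.Nonempty := Finset.card_pos.mp (by omega)
    obtain ⟨t, ht, hh⟩ := Finset.exists_mem_eq_sup T hne id
    rw [hh]
    exact hT.1 ht
  rw [← Finset.sum_fiberwise_of_maps_to hmaps]
  refine Finset.sum_le_sum fun u hu => ?_
  have e3 : ∑ T ∈ TT with T.sup id = u, 2 * W (T.sup id) =
      ((TT.filter (fun T => T.sup id = u)).card : ℝ) * (2 * W u) := by
    rw [← nsmul_eq_mul, ← Finset.sum_const]
    refine Finset.sum_congr rfl fun T hT => ?_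
    rw [(Finset.mem_filter.mp hT).2]
  rw [e3]
  have e4 : (2 : ℝ) * ((TT.filter (fun T => T.sup id = u)).card : ℝ) ≤ (u : ℝ) ^ 2 := by
    exact_mod_cast sup_count B u
  have := mul_le_mul_of_nonneg_right e4 (hW u)
  linarith

lemma fact_lemma (n a : ℕ) (ha : 1 ≤ a) (han : a ≤ n)
    (hp : ∀ p, p.Prime → p ∣ a → p ^ 6 ≤ n ^ 5) :
    (∃ e : ℕ × ℕ, (e.1 ^ 2 ≤ n ∧ e.2 ^ 2 ≤ n) ∧ e.1 * e.2 = a) ∨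
    (∃ e : ℕ × ℕ, (n ≤ e.2 ^ 2 ∧ e.2 ^ 6 ≤ n ^ 5) ∧ e.1 * e.2 = a) := by
  classical
  rcases lt_or_ge (a ^ 2) n with h | h
  · exact Or.inl ⟨(1, a), ⟨by simp; omega, h.le⟩, by simp⟩
  · have hex : ∃ v, v ∣ a ∧ n ≤ v ^ 2 := ⟨a, dvd_rfl, h⟩
    obtain ⟨v, hv⟩ : ∃ v, v = Nat.find hex := ⟨_, rfl⟩
    obtain ⟨hva, hvn⟩ := Nat.find_spec hex
    have hmin : ∀ w, w < v → w ∣ a → w ^ 2 < n := by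
      intro w hw hwa
      have := Nat.find_min hex (hv ▸ hw)
      by_contra hcon
      exact this ⟨hwa, by omega⟩
    rw [← hv] at hva hvn
    obtain ⟨r, hr⟩ := hva
    rcases le_or_gt (v ^ 6) (n ^ 5) with h6 | h6
    · exact Or.inr ⟨(r, v), ⟨hvn, h6⟩, by rw [hr]; ring⟩
    have hv1 : v ≠ 1 := by
      rintro rfl
      have : 1 ≤ n ^ 5 := Nat.one_le_pow _ _ (by omega)
      omega
    obtain ⟨p, hpp, e, he⟩ := Nat.exists_prime_and_dvd hv1
    have hpa : p ∣ a := ⟨e * r, by rw [hr, he]; ring⟩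
    have hvpos : 0 < v := by
      rcases Nat.eq_zero_or_pos v with h0 | h0
      · subst h0; simp at h6
      · exact h0
    have hepos : 0 < e := by
      rcases Nat.eq_zero_or_pos e with h0 | h0
      · subst h0; omega
      · exact h0
    have hpv : p < v := by
      refine lt_of_le_of_ne (by rw [he]; exact Nat.le_mul_of_pos_right _ hepos) ?_
      rintro rfl
      have := hp p hpp hpa
      omega
    have hev : e < v := by
      have := hpp.two_le
      rw [he]; nlinarith
    have hp2 := hmin p hpv hpa
    have he2 := hmin e hev ⟨p * r, by rw [hr, he]; ring⟩
    have hr6 : r ^ 6 ≤ n := by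
      by_contra hcon
      push Not at hcon
      have h1 : n ^ 5 * n < v ^ 6 * r ^ 6 := Nat.mul_lt_mul'' h6 hcon
      have h2 : (v * r) ^ 6 ≤ n ^ 6 := Nat.pow_le_pow_left (hr ▸ han) 6
      rw [mul_pow] at h2
      have : n ^ 5 * n = n ^ 6 := by ring
      omega
    have hw6 : (p * r) ^ 6 ≤ n ^ 5 := by
      have h1 : (p ^ 2) ^ 3 ≤ n ^ 3 := Nat.pow_le_pow_left hp2.le 3
      calc (p * r) ^ 6 = (p ^ 2) ^ 3 * r ^ 6 := by ring
        _ ≤ n ^ 3 * n := Nat.mul_le_mul h1 hr6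
        _ = n ^ 4 := by ring
        _ ≤ n ^ 5 := Nat.pow_le_pow_right (by omega) (by norm_num)
    rcases le_or_gt ((p * r) ^ 2) n with h7 | h7
    · exact Or.inl ⟨(e, p * r), ⟨he2.le, h7⟩, by simp only; rw [hr, he]; ring⟩
    · exact Or.inr ⟨(e, p * r), ⟨h7.le, hw6⟩, by simp only; rw [hr, he]; ring⟩


/-- real cube root of a natural number -/
noncomputable def kap (v : ℕ) : ℝ := (v : ℝ) ^ (1 / 3 : ℝ)

lemma kap_cube (v : ℕ) : kap v ^ 3 = v := by
  rw [kap, ← Real.rpow_natCast, ← Real.rpow_mul (by positivity)]; norm_num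

lemma kap_nonneg (v : ℕ) : 0 ≤ kap v := by rw [kap]; positivity

lemma kap_pos (v : ℕ) (hv : 1 ≤ v) : 0 < kap v := by
  rw [kap]; have : (0 : ℝ) < v := by exact_mod_cast hv
  positivity

lemma kap_mono (u v : ℕ) (h : u ≤ v) : kap u ≤ kap v := by
  rw [kap, kap]; gcongr

lemma sum_kap2 (B : ℕ) : ∑ u ∈ Finset.Icc 1 B, 1 / kap u ^ 2 ≤ 3 * kap B := by
  induction B with
  | zero => simp [kap]
  | succ B ih =>
    rw [Finset.sum_Icc_succ_top (by omega)]
    have h1 := kap_pos (B + 1) (by omega)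
    have h0 := kap_nonneg B
    have hm := kap_mono B (B + 1) (by omega)
    have c1 := kap_cube (B + 1)
    have c0 := kap_cube B
    push_cast at c1
    have : 1 / kap (B + 1) ^ 2 ≤ 3 * kap (B + 1) - 3 * kap B := by
      rw [div_le_iff₀ (by positivity)]
      have hd : 0 ≤ kap (B + 1) - kap B := by linarith
      have hq : kap (B + 1) ^ 2 + kap (B + 1) * kap B + kap B ^ 2 ≤ 3 * kap (B + 1) ^ 2 := by
        nlinarith
      have := mul_le_mul_of_nonneg_left hq hd
      nlinarith
    linarith

lemma sum_kap4 (a b : ℕ) (ha : 1 ≤ a) :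
    ∑ v ∈ Finset.Ioc a b, 1 / kap v ^ 4 ≤ 3 / kap a := by
  rcases lt_or_ge b a with hb | hb
  · rw [Finset.Ioc_eq_empty (by omega)]
    have := kap_pos a ha
    simp only [Finset.sum_empty]; positivity
  suffices h : ∑ v ∈ Finset.Ioc a b, 1 / kap v ^ 4 ≤ 3 / kap a - 3 / kap b by
    have := kap_pos b (by omega)
    have : 0 < 3 / kap b := by positivity
    linarith
  induction b, hb using Nat.le_induction with
  | base => simp
  | succ b hb ih =>
    rw [Finset.sum_Ioc_succ_top (by omega)]
    have h1 := kap_pos (b + 1) (by omega)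
    have h0 := kap_pos b (by omega)
    have hm := kap_mono b (b + 1) (by omega)
    have c1 := kap_cube (b + 1)
    have c0 := kap_cube b
    push_cast at c1
    have : 1 / kap (b + 1) ^ 4 ≤ 3 / kap b - 3 / kap (b + 1) := by
      generalize kap (b + 1) = t at *
      generalize kap b = s at *
      have hd : 0 ≤ t - s := by linarith
      have hq : t ^ 2 + t * s + s ^ 2 ≤ 3 * t ^ 2 := by nlinarith
      have h2 : 1 ≤ 3 * t ^ 2 * (t - s) := by
        have := mul_le_mul_of_nonneg_left hq hd
        nlinarith
      rw [div_sub_div _ _ h0.ne' h1.ne', div_le_div_iff₀ (by positivity) (by positivity)]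
      have h3 : s * t ≤ t ^ 2 := by nlinarith
      have h4 : t ^ 2 * 1 ≤ t ^ 2 * (3 * t ^ 2 * (t - s)) :=
        mul_le_mul_of_nonneg_left h2 (by positivity)
      nlinarith
    linarith

lemma card_split (E : Finset (ℕ × ℕ)) (V : Finset ℕ) (h : ∀ e ∈ E, e.2 ∈ V) :
    (E.card : ℝ) = ∑ v ∈ V, ((E.filter (fun e => e.2 = v)).card : ℝ) := by
  rw [Finset.card_eq_sum_card_fiberwise (f := Prod.snd) (t := V) h]
  push_cast
  rfl

lemma part1 (n : ℕ) (g : ℝ) (hg : 1 ≤ g) (hgn : g ^ 6 = n) (E : Finset (ℕ × ℕ)) (hK : K33Free E)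
    (h : ∀ e ∈ E, e.1 ^ 2 ≤ n ∧ e.2 ^ 2 ≤ n ∧ 1 ≤ e.1 * e.2) : (E.card : ℝ) ≤ 9 * g ^ 5 := by
  obtain ⟨B, hB⟩ : ∃ B, B = Nat.sqrt n := ⟨_, rfl⟩
  have hBg : (B : ℝ) ≤ g ^ 3 := by
    have : B ^ 2 ≤ n := by rw [hB]; exact Nat.sqrt_le' n
    have : (B : ℝ) ^ 2 ≤ (g ^ 3) ^ 2 := by
      rw [← pow_mul, hgn]; exact_mod_cast this
    exact le_of_pow_le_pow_left₀ (by norm_num) (by positivity) this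
  have hmem : ∀ e ∈ E, (1 ≤ e.1 ∧ e.1 ≤ B) ∧ (1 ≤ e.2 ∧ e.2 ≤ B) := by
    intro e he
    obtain ⟨a, b, c⟩ := h e he
    refine ⟨⟨Nat.pos_of_mul_pos_right c, ?_⟩, ⟨Nat.pos_of_mul_pos_left c, ?_⟩⟩
    · rw [hB]; exact Nat.le_sqrt'.mpr a
    · rw [hB]; exact Nat.le_sqrt'.mpr b
  rw [card_split E (Finset.Icc 1 B) (fun e he => Finset.mem_Icc.mpr (hmem e he).2)]
  have k := kst E hK (Finset.Icc 1 B) B (fun _ => 1 / (g ^ 2) ^ 2) (fun _ => 1 / (g ^ 2) ^ 2)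
    (fun e he => (hmem e he).1) (fun _ => by positivity) (fun _ _ => le_rfl)
  have s1 : ∑ u ∈ Finset.Icc 1 B, (u : ℝ) ^ 2 * (1 / (g ^ 2) ^ 2) ≤ g ^ 5 := by
    have := Finset.sum_le_card_nsmul (Finset.Icc 1 B) (fun u : ℕ => (u : ℝ) ^ 2 * (1 / (g ^ 2) ^ 2))
      (g ^ 2) (by
        intro u hu
        have hu' : (u : ℝ) ≤ g ^ 3 := le_trans (by exact_mod_cast (Finset.mem_Icc.mp hu).2) hBg
        have : (u : ℝ) ^ 2 ≤ (g ^ 3) ^ 2 := by gcongr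
        rw [mul_one_div, div_le_iff₀ (by positivity)]
        calc (u : ℝ) ^ 2 ≤ (g ^ 3) ^ 2 := this
          _ = g ^ 2 * (g ^ 2) ^ 2 := by ring)
    refine this.trans ?_
    rw [nsmul_eq_mul, Nat.card_Icc, Nat.add_sub_cancel]
    calc (B : ℝ) * g ^ 2 ≤ g ^ 3 * g ^ 2 := by gcongr
      _ = g ^ 5 := by ring
  refine (Finset.sum_le_sum fun v _ => deg_ineq _ (g ^ 2) (by positivity)).trans ?_
  rw [Finset.sum_add_distrib, ← Finset.mul_sum, Finset.sum_const, nsmul_eq_mul, Nat.card_Icc,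
    Nat.add_sub_cancel]
  have h2 : (2 : ℝ) + g ^ 2 ≤ 3 * g ^ 2 := by nlinarith
  have h3 : (B : ℝ) * (2 + g ^ 2) ≤ g ^ 3 * (3 * g ^ 2) := by gcongr
  have h4 : g ^ 3 * (3 * g ^ 2) = 3 * g ^ 5 := by ring
  linarith

lemma part2 (n : ℕ) (g : ℝ) (hg : 2 ≤ g) (hgn : g ^ 6 = n) (E : Finset (ℕ × ℕ)) (hK : K33Free E)
    (h : ∀ e ∈ E, n ≤ e.2 ^ 2 ∧ e.2 ^ 6 ≤ n ^ 5 ∧ 1 ≤ e.1 * e.2 ∧ e.1 * e.2 ≤ n) :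
    (E.card : ℝ) ≤ 26 * g ^ 5 := by
  obtain ⟨B, hB⟩ : ∃ B, B = Nat.sqrt n := ⟨_, rfl⟩
  have hg0 : 0 < g := by linarith
  have hBg : (B : ℝ) ≤ g ^ 3 := by
    have : B ^ 2 ≤ n := by rw [hB]; exact Nat.sqrt_le' n
    have : (B : ℝ) ^ 2 ≤ (g ^ 3) ^ 2 := by
      rw [← pow_mul, hgn]; exact_mod_cast this
    exact le_of_pow_le_pow_left₀ (by norm_num) (by positivity) this
  have hBg2 : g ^ 3 ≤ (B : ℝ) + 1 := by
    have : n < (B + 1) ^ 2 := by rw [hB]; exact Nat.lt_succ_sqrt' n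
    have : (g ^ 3) ^ 2 ≤ ((B : ℝ) + 1) ^ 2 := by
      rw [← pow_mul, hgn]; exact_mod_cast this.le
    exact le_of_pow_le_pow_left₀ (by norm_num) (by positivity) this
  have hg3 : (8 : ℝ) ≤ g ^ 3 := by
    calc (8 : ℝ) = 2 ^ 3 := by norm_num
      _ ≤ g ^ 3 := by gcongr
  have hB2 : 2 ≤ B := by
    have : (2 : ℝ) ≤ B := by linarith
    exact_mod_cast this
  obtain ⟨D, hD⟩ : ∃ D : ℕ, D = ⌊g ^ 5⌋₊ := ⟨_, rfl⟩
  have hDg : (D : ℝ) ≤ g ^ 5 := by rw [hD]; exact Nat.floor_le (by positivity)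
  have hmem : ∀ e ∈ E, (1 ≤ e.1 ∧ e.1 ≤ B) ∧ (1 ≤ e.2 ∧ B - 1 < e.2 ∧ e.2 ≤ D) := by
    intro e he
    obtain ⟨a, b, c, d⟩ := h e he
    have c1 := Nat.pos_of_mul_pos_right c
    have c2 := Nat.pos_of_mul_pos_left c
    refine ⟨⟨c1, ?_⟩, ⟨c2, ?_, ?_⟩⟩
    · rw [hB, Nat.le_sqrt']
      have h1 : (e.1 * e.2) ^ 2 ≤ n ^ 2 := Nat.pow_le_pow_left d 2
      have h2 : e.1 ^ 2 * n ≤ n * n := by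
        calc e.1 ^ 2 * n ≤ e.1 ^ 2 * e.2 ^ 2 := Nat.mul_le_mul_left _ a
          _ = (e.1 * e.2) ^ 2 := by ring
          _ ≤ n ^ 2 := h1
          _ = n * n := by ring
      exact Nat.le_of_mul_le_mul_right h2 (by omega)
    · have h1 : B ^ 2 ≤ n := by rw [hB]; exact Nat.sqrt_le' n
      have h2 : B ≤ e.2 := le_of_pow_le_pow_left₀ (n := 2) (by norm_num) (by omega) (h1.trans a)
      omega
    · rw [hD]
      apply Nat.le_floor
      have : (e.2 : ℝ) ^ 6 ≤ (g ^ 5) ^ 6 := by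
        rw [← pow_mul, show 5 * 6 = 6 * 5 by norm_num, pow_mul, hgn]; exact_mod_cast b
      exact le_of_pow_le_pow_left₀ (by norm_num) (by positivity) this
  rw [card_split E (Finset.Ioc (B - 1) D) (fun e he => Finset.mem_Ioc.mpr (hmem e he).2.2)]
  have hkn : kap n = g ^ 2 := by
    have h1 : kap n ^ 3 = (g ^ 2) ^ 3 := by rw [kap_cube, ← hgn]; ring
    exact (pow_left_inj₀ (kap_nonneg n) (by positivity) (by norm_num)).mp h1
  have k := kst E hK (Finset.Ioc (B - 1) D) B (fun v => 1 / (g ^ 6 / kap v ^ 4) ^ 2)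
    (fun u => g ^ 4 / kap u ^ 8) (fun e he => (hmem e he).1)
    (fun u => by have := kap_nonneg u; positivity) (by
      intro e he
      obtain ⟨⟨h1, -⟩, h2, -⟩ := hmem e he
      have k1 := kap_pos _ h1
      have k2 := kap_pos _ h2
      have h3 : kap e.1 * kap e.2 ≤ g ^ 2 := by
        have : (kap e.1 * kap e.2) ^ 3 ≤ (g ^ 2) ^ 3 := by
          rw [mul_pow, kap_cube, kap_cube, ← pow_mul, hgn]
          exact_mod_cast (h e he).2.2.2
        exact le_of_pow_le_pow_left₀ (by norm_num) (by positivity) this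
      have h4 : (kap e.1 * kap e.2) ^ 8 ≤ (g ^ 2) ^ 8 := by gcongr
      rw [div_le_div_iff₀ (by positivity) (by positivity), div_pow, mul_div_assoc',
        le_div_iff₀ (by positivity)]
      calc 1 * kap e.1 ^ 8 * (kap e.2 ^ 4) ^ 2 = (kap e.1 * kap e.2) ^ 8 := by ring
        _ ≤ (g ^ 2) ^ 8 := h4
        _ = g ^ 4 * (g ^ 6) ^ 2 := by ring)
  have s1 : ∑ u ∈ Finset.Icc 1 B, (u : ℝ) ^ 2 * (g ^ 4 / kap u ^ 8) ≤ 3 * g ^ 5 := by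
    have e1 : ∑ u ∈ Finset.Icc 1 B, (u : ℝ) ^ 2 * (g ^ 4 / kap u ^ 8) =
        g ^ 4 * ∑ u ∈ Finset.Icc 1 B, 1 / kap u ^ 2 := by
      rw [Finset.mul_sum]
      refine Finset.sum_congr rfl fun u hu => ?_
      have k1 := kap_pos u (Finset.mem_Icc.mp hu).1
      rw [← kap_cube u]
      field_simp
    have h1 : kap B ≤ g := by
      have : kap B ^ 3 ≤ g ^ 3 := by rw [kap_cube]; exact hBg
      exact le_of_pow_le_pow_left₀ (by norm_num) (by positivity) this
    rw [e1]
    calc g ^ 4 * ∑ u ∈ Finset.Icc 1 B, 1 / kap u ^ 2 ≤ g ^ 4 * (3 * kap B) := by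
          gcongr; exact sum_kap2 B
      _ ≤ g ^ 4 * (3 * g) := by gcongr
      _ = 3 * g ^ 5 := by ring
  have s2 : ∑ v ∈ Finset.Ioc (B - 1) D, g ^ 6 / kap v ^ 4 ≤ 6 * g ^ 5 := by
    have e1 : ∑ v ∈ Finset.Ioc (B - 1) D, g ^ 6 / kap v ^ 4 =
        g ^ 6 * ∑ v ∈ Finset.Ioc (B - 1) D, 1 / kap v ^ 4 := by
      rw [Finset.mul_sum]
      exact Finset.sum_congr rfl fun u hu => by ring
    have h1 : g / 2 ≤ kap (B - 1) := by
      have : (g / 2) ^ 3 ≤ kap (B - 1) ^ 3 := by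
        rw [kap_cube, Nat.cast_sub (by omega), div_pow]
        push_cast
        linarith
      exact le_of_pow_le_pow_left₀ (by norm_num) (kap_nonneg _) this
    rw [e1]
    calc g ^ 6 * ∑ v ∈ Finset.Ioc (B - 1) D, 1 / kap v ^ 4 ≤ g ^ 6 * (3 / kap (B - 1)) := by
          gcongr; exact sum_kap4 _ _ (by omega)
      _ ≤ g ^ 6 * (3 / (g / 2)) := by gcongr
      _ = 6 * g ^ 5 := by field_simp; norm_num
  refine (Finset.sum_le_sum fun v hv => deg_ineq _ (g ^ 6 / kap v ^ 4) (by
    have := kap_pos v (by have := Finset.mem_Ioc.mp hv; omega)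
    positivity)).trans ?_
  rw [Finset.sum_add_distrib, ← Finset.mul_sum, Finset.sum_add_distrib, Finset.sum_const,
    nsmul_eq_mul, Nat.card_Ioc]
  have h5 : ((D - (B - 1) : ℕ) : ℝ) ≤ g ^ 5 := le_trans (by exact_mod_cast Nat.sub_le _ _) hDg
  linarith

lemma part3 (n : ℕ) (g : ℝ) (hg : 1 ≤ g) (hgn : g ^ 6 = n) (E : Finset (ℕ × ℕ)) (hK : K33Free E)
    (h : ∀ e ∈ E, e.2.Prime ∧ n ^ 5 < e.2 ^ 6 ∧ 1 ≤ e.1 * e.2 ∧ e.1 * e.2 ≤ n) :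
    (E.card : ℝ) ≤ Nat.primeCounting n + Nat.primeCounting (n / 2) + g ^ 5 := by
  classical
  have hg0 : 0 < g := by linarith
  obtain ⟨B, hB⟩ : ∃ B : ℕ, B = ⌊g⌋₊ := ⟨_, rfl⟩
  have hBg : (B : ℝ) ≤ g := by rw [hB]; exact Nat.floor_le (by positivity)
  have hmem : ∀ e ∈ E, (1 ≤ e.1 ∧ e.1 ≤ B) := by
    intro e he
    obtain ⟨a, b, c, d⟩ := h e he
    refine ⟨Nat.pos_of_mul_pos_right c, ?_⟩
    have : e.1 ^ 6 ≤ n := by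
      by_contra hcon
      push Not at hcon
      have h1 : n * n ^ 5 < e.1 ^ 6 * e.2 ^ 6 := Nat.mul_lt_mul'' hcon b
      have h2 : (e.1 * e.2) ^ 6 ≤ n ^ 6 := Nat.pow_le_pow_left d 6
      rw [mul_pow] at h2
      have : n * n ^ 5 = n ^ 6 := by ring
      omega
    rw [hB]
    apply Nat.le_floor
    have : (e.1 : ℝ) ^ 6 ≤ g ^ 6 := by rw [hgn]; exact_mod_cast this
    exact le_of_pow_le_pow_left₀ (by norm_num) (by positivity) this
  have hle : ∀ e ∈ E, e.2 ≤ n := by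
    intro e he
    exact le_trans (Nat.le_mul_of_pos_left _ (hmem e he).1) (h e he).2.2.2
  rw [card_split E (Nat.primesLE n) (fun e he => Nat.mem_primesLE.mpr ⟨hle e he, (h e he).1⟩)]
  have k := kst E hK (Nat.primesLE n) B (fun _ => 1) (fun _ => 1) hmem (fun _ => by norm_num)
    (fun _ _ => le_rfl)
  have s1 : ∑ u ∈ Finset.Icc 1 B, (u : ℝ) ^ 2 * 1 ≤ g ^ 5 := by
    have := Finset.sum_le_card_nsmul (Finset.Icc 1 B) (fun u : ℕ => (u : ℝ) ^ 2 * 1) (g ^ 2) (by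
        intro u hu
        have hu' : (u : ℝ) ≤ g := le_trans (by exact_mod_cast (Finset.mem_Icc.mp hu).2) hBg
        rw [mul_one]
        gcongr)
    refine this.trans ?_
    rw [nsmul_eq_mul, Nat.card_Icc, Nat.add_sub_cancel]
    calc (B : ℝ) * g ^ 2 ≤ g * g ^ 2 := by gcongr
      _ = g ^ 3 := by ring
      _ ≤ g ^ 5 := pow_le_pow_right₀ hg (by norm_num)
  have hdeg : ∀ v ∈ Nat.primesLE n, ((E.filter (fun e => e.2 = v)).card : ℝ) ≤
      (1 + if v ≤ n / 2 then 1 else 0) +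
        1 * ((E.filter (fun e => e.2 = v)).card.choose 3 : ℝ) := by
    intro v hv
    split_ifs with hv2
    · have := deg_ineq' (E.filter (fun e => e.2 = v)).card
      have : ((E.filter (fun e => e.2 = v)).card : ℝ) ≤
        2 + ((E.filter (fun e => e.2 = v)).card.choose 3 : ℝ) := by exact_mod_cast this
      linarith
    · have h1 : (E.filter (fun e => e.2 = v)).card ≤ 1 := by
        rw [Finset.card_le_one]
        have key : ∀ e ∈ E.filter (fun e => e.2 = v), e = (1, v) := by
          rintro ⟨u, v'⟩ he
          rw [Finset.mem_filter] at he
          obtain ⟨he, rfl⟩ := he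
          have h2 := (h _ he).2.2.2
          have h3 := (hmem _ he).1
          simp only at h2 h3 hv2
          have : u < 2 := by
            by_contra hcon
            have : 2 * v' ≤ u * v' := Nat.mul_le_mul_right _ (by omega)
            omega
          have : u = 1 := by omega
          rw [this]
        intro a ha b hb
        rw [key a ha, key b hb]
      have h2 : ((E.filter (fun e => e.2 = v)).card : ℝ) ≤ 1 := by exact_mod_cast h1
      have h3 : (0 : ℝ) ≤ ((E.filter (fun e => e.2 = v)).card.choose 3 : ℝ) := by positivity
      linarith
  refine (Finset.sum_le_sum hdeg).trans ?_
  rw [Finset.sum_add_distrib, Finset.sum_add_distrib, Finset.sum_const, ← Finset.sum_filter,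
    Finset.sum_const, Nat.primesLE_card_eq_primeCounting]
  have hf : (Nat.primesLE n).filter (fun v => v ≤ n / 2) = Nat.primesLE (n / 2) := by
    ext p
    simp only [Finset.mem_filter, Nat.mem_primesLE]
    constructor
    · rintro ⟨⟨a, b⟩, c⟩; exact ⟨c, b⟩
    · rintro ⟨a, b⟩; exact ⟨⟨by omega, b⟩, a⟩
  rw [hf, Nat.primesLE_card_eq_primeCounting]
  simp only [nsmul_eq_mul, mul_one]
  linarith

lemma upper_bound (n : ℕ) (hn : 64 ≤ n) :
    (Fkd 9 3 n : ℝ) ≤ (Nat.primeCounting n : ℝ) + (Nat.primeCounting (n / 2) : ℝ)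
            + 36 * (n : ℝ) ^ ((5 : ℝ)/6) := by
  classical
  obtain ⟨g, hg⟩ : ∃ g : ℝ, g = (n : ℝ) ^ (1 / 6 : ℝ) := ⟨_, rfl⟩
  have hgn : g ^ 6 = n := by
    rw [hg, ← Real.rpow_natCast, ← Real.rpow_mul (by positivity)]; norm_num
  have hg5 : (n : ℝ) ^ ((5 : ℝ)/6) = g ^ 5 := by
    rw [hg, ← Real.rpow_natCast, ← Real.rpow_mul (by positivity)]; norm_num
  have hg0 : 0 ≤ g := by rw [hg]; positivity
  have hg2 : 2 ≤ g := by
    have : (2 : ℝ) ^ 6 ≤ g ^ 6 := by rw [hgn]; norm_num; exact_mod_cast hn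
    exact le_of_pow_le_pow_left₀ (by norm_num) hg0 this
  rw [hg5]
  have main : ∀ A : Finset ℕ, A ⊆ Finset.Icc 1 n →
      (∀ S ⊆ A, S.card = 9 → ∀ x, 0 < x → ∏ s ∈ S, s ≠ x ^ 3) →
      (A.card : ℝ) ≤ (Nat.primeCounting n : ℝ) + (Nat.primeCounting (n / 2) : ℝ) + 36 * g ^ 5 := by
    intro A hAn hA
    have hA0 : 0 ∉ A := fun h => by have := Finset.mem_Icc.mp (hAn h); omega
    have hb : ∀ a ∈ A, 1 ≤ a ∧ a ≤ n := fun a ha => Finset.mem_Icc.mp (hAn ha)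
    let Q3 : ℕ → Prop := fun a => ∃ e : ℕ × ℕ, (e.2.Prime ∧ n ^ 5 < e.2 ^ 6) ∧ e.1 * e.2 = a
    let Q1 : ℕ → Prop := fun a => ∃ e : ℕ × ℕ, (e.1 ^ 2 ≤ n ∧ e.2 ^ 2 ≤ n) ∧ e.1 * e.2 = a
    let Q2 : ℕ → Prop := fun a => ∃ e : ℕ × ℕ, (n ≤ e.2 ^ 2 ∧ e.2 ^ 6 ≤ n ^ 5) ∧ e.1 * e.2 = a
    have hcov : A ⊆ A.filter Q1 ∪ A.filter Q2 ∪ A.filter Q3 := by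
      intro a ha
      simp only [Finset.mem_union, Finset.mem_filter]
      by_cases h3 : Q3 a
      · exact Or.inr ⟨ha, h3⟩
      · left
        have := fact_lemma n a (hb a ha).1 (hb a ha).2 (by
          intro p hp hpa
          by_contra hcon
          obtain ⟨u, hu⟩ := hpa
          exact h3 ⟨(u, p), ⟨hp, by simpa using hcon⟩, by rw [hu]; ring⟩)
        rcases this with h | h
        · exact Or.inl ⟨ha, h⟩
        · exact Or.inr ⟨ha, h⟩
    obtain ⟨E1, hK1, hc1, hE1⟩ := rep_lemma A (A.filter Q1) hA0 (Finset.filter_subset _ _) hA _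
      (fun a ha => (Finset.mem_filter.mp ha).2)
    obtain ⟨E2, hK2, hc2, hE2⟩ := rep_lemma A (A.filter Q2) hA0 (Finset.filter_subset _ _) hA _
      (fun a ha => (Finset.mem_filter.mp ha).2)
    obtain ⟨E3, hK3, hc3, hE3⟩ := rep_lemma A (A.filter Q3) hA0 (Finset.filter_subset _ _) hA _
      (fun a ha => (Finset.mem_filter.mp ha).2)
    have p1 := part1 n g (by linarith) hgn E1 hK1 (fun e he =>
      ⟨(hE1 e he).1.1, (hE1 e he).1.2, (hb _ (hE1 e he).2).1⟩)
    have p2 := part2 n g hg2 hgn E2 hK2 (fun e he =>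
      ⟨(hE2 e he).1.1, (hE2 e he).1.2, hb _ (hE2 e he).2⟩)
    have p3 := part3 n g (by linarith) hgn E3 hK3 (fun e he =>
      ⟨(hE3 e he).1.1, (hE3 e he).1.2, hb _ (hE3 e he).2⟩)
    have hc := (Finset.card_le_card hcov).trans ((Finset.card_union_le _ _).trans
      (Nat.add_le_add_right (Finset.card_union_le _ _) _))
    rw [← hc1, ← hc2, ← hc3] at hc
    have hc' : (A.card : ℝ) ≤ E1.card + E2.card + E3.card := by exact_mod_cast hc
    linarith
  have hfl : Fkd 9 3 n ≤ ⌊(Nat.primeCounting n : ℝ) + (Nat.primeCounting (n / 2) : ℝ)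
      + 36 * g ^ 5⌋₊ :=
    Fkd_le 9 3 n _ (fun A h1 h2 => Nat.le_floor (main A h1 h2)) (by norm_num)
  exact le_trans (by exact_mod_cast hfl) (Nat.floor_le (by positivity))


theorem stmt_11 : ∃ c1 c2 : ℝ, 0 < c1 ∧ 0 < c2 ∧ ∀ᶠ n : ℕ in Filter.atTop,
    (Nat.primeCounting n : ℝ) + (Nat.primeCounting (n / 2) : ℝ)
        + c1 * (n : ℝ) ^ ((5 : ℝ)/6) / (Real.log n) ^ ((5 : ℝ)/3)
        ≤ (Fkd 9 3 n : ℝ) ∧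
    (Fkd 9 3 n : ℝ)
        ≤ (Nat.primeCounting n : ℝ) + (Nat.primeCounting (n / 2) : ℝ)
            + c2 * (n : ℝ) ^ ((5 : ℝ)/6) := by
  obtain ⟨c1, hc1, h⟩ := lower_bound
  refine ⟨c1, 36, hc1, by norm_num, ?_⟩
  filter_upwards [h, eventually_ge_atTop 64] with n h1 h2
  exact ⟨h1, upper_bound n h2⟩
end

section
/- There exist positive real constants c1 and c2 such that for every sufficiently large positive integer n, π(n) + π(⌊n/2⌋) + π(⌊n/3⌋) + c1·n^{3/4}/(log n)^{3/2} ≤ F_{12,3}(n) ≤ π(n) + π(⌊n/2⌋) + π(⌊n/3⌋) + c2·n^{5/6}. -/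
open Finset Filter

lemma exists_decomp (n m : ℕ) (hm : 1 ≤ m) (hmn : m ≤ n) :
    ∃ u v, u * v = m ∧ v ^ 2 ≤ n ∧ (u.Prime ∨ u ^ 4 ≤ n ^ 3) := by
  by_cases h : ∃ p, p.Prime ∧ p ∣ m ∧ n < p ^ 2
  · obtain ⟨p, hp, ⟨v, rfl⟩, h2⟩ := h
    refine ⟨p, v, rfl, ?_, Or.inl hp⟩
    by_contra hv
    push Not at hv
    have h3 : n * n < p ^ 2 * v ^ 2 := Nat.mul_lt_mul'' h2 hv
    have h4 : (p * v) * (p * v) ≤ n * n := Nat.mul_le_mul hmn hmn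
    nlinarith
  · push Not at h
    have hne : (m.divisors.filter (fun v => v ^ 2 ≤ n)).Nonempty := by
      refine ⟨1, ?_⟩
      simp
      omega
    obtain ⟨v, hv, hmax⟩ := Finset.exists_max_image _ id hne
    simp only [Finset.mem_filter, Nat.mem_divisors, id] at hv hmax
    obtain ⟨⟨⟨u, hu⟩, hm0⟩, hvn⟩ := hv
    refine ⟨u, v, by rw [hu, mul_comm], hvn, Or.inr ?_⟩
    have hn : 1 ≤ n := le_trans hm hmn
    by_cases hu1 : u = 1
    · subst hu1
      simpa using Nat.one_le_pow _ _ hn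
    obtain ⟨q, hq, w, hw⟩ := Nat.exists_prime_and_dvd hu1
    have hqm : q ∣ m := ⟨v * w, by rw [hu, hw]; ring⟩
    have hqv : q ≤ v := hmax q ⟨⟨hqm, hm0⟩, h q hq hqm⟩
    have hvpos : 0 < v := by
      rcases Nat.eq_zero_or_pos v with h0 | h0
      · subst h0; simp at hu; omega
      · exact h0
    have hbig : n < (v * q) ^ 2 := by
      by_contra hc
      push Not at hc
      have := hmax (v * q) ⟨⟨⟨w, by rw [hu, hw]; ring⟩, hm0⟩, hc⟩
      have := hq.two_le
      nlinarith
    have h4 : n < v ^ 4 := by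
      calc n < (v * q) ^ 2 := hbig
        _ ≤ (v * v) ^ 2 := by gcongr
        _ = v ^ 4 := by ring
    have h5 : u ^ 4 * v ^ 4 ≤ n ^ 4 := by
      rw [← mul_pow, mul_comm, ← hu]; gcongr
    by_contra hc
    push Not at hc
    have : n ^ 3 * n < u ^ 4 * v ^ 4 := Nat.mul_lt_mul'' hc h4
    nlinarith

lemma no_cube_finset {k d : ℕ} {A : Finset ℕ}
    (hA : ∀ (a : Fin k → ℕ) (x : ℕ), (∀ i, a i ∈ A) → StrictMono a → 0 < x →
      (∏ i, a i) ≠ x ^ d) (S : Finset ℕ) (hS : S ⊆ A) (hc : S.card = k) (x : ℕ) (hx : 0 < x) :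
    ∏ m ∈ S, m ≠ x ^ d := by
  have := hA (S.orderEmbOfFin hc) x (fun i => hS (S.orderEmbOfFin_mem hc i))
    (S.orderEmbOfFin hc).strictMono hx
  intro h
  apply this
  rw [← h]
  conv_rhs => rw [← S.map_orderEmbOfFin_univ hc]
  rw [Finset.prod_map]
  rfl

lemma four_indices (C : Fin 4 → Finset ℕ) (hC : ∀ i, 4 ≤ (C i).card) :
    ∃ u : Fin 4 → ℕ, Function.Injective u ∧ ∀ i, u i ∈ C i := by
  have h := (Finset.all_card_le_biUnion_card_iff_exists_injective C).1 ?_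
  · exact h
  · intro s
    rcases s.eq_empty_or_nonempty with rfl | ⟨i, hi⟩
    · simp
    · calc s.card ≤ 4 := by simpa using s.card_le_univ
        _ ≤ (C i).card := hC i
        _ ≤ _ := Finset.card_le_card (Finset.subset_biUnion_of_mem C hi)

lemma bad_count (I : Finset ℕ) (D : ℕ → Finset ℕ)
    (hQ : ∀ u v : Fin 4 → ℕ, Function.Injective u → Function.Injective v → (∀ i, u i ∈ I) →
      ¬ (∀ i j, i ≠ j → v j ∈ D (u i))) (u : ℕ) (hd : 4 ≤ (D u).card) :
    (D u).card ^ 3 ≤ 256 * (((D u).powersetCard 3).filter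
      (fun t => (I.filter (fun u => t ⊆ D u)).card ≤ 3)).card := by
  set B := ((D u).powersetCard 3).filter
      (fun t => (I.filter (fun u => t ⊆ D u)).card ≤ 3) with hB
  have hsub : (D u).powersetCard 4 ⊆ Finset.image₂ (fun t x => insert x t) B (D u) := by
    intro Q hQ4
    rw [Finset.mem_powersetCard] at hQ4
    obtain ⟨hQD, hQc⟩ := hQ4
    by_contra hno
    have hgood : ∀ x ∈ Q, 4 ≤ (I.filter (fun u => Q.erase x ⊆ D u)).card := by
      intro x hx
      by_contra hlt
      apply hno
      rw [Finset.mem_image₂]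
      refine ⟨Q.erase x, ?_, x, hQD hx, Finset.insert_erase hx⟩
      rw [hB, Finset.mem_filter, Finset.mem_powersetCard]
      refine ⟨⟨(Finset.erase_subset _ _).trans hQD, ?_⟩, by omega⟩
      rw [Finset.card_erase_of_mem hx, hQc]
    let v : Fin 4 → ℕ := Q.orderEmbOfFin hQc
    have hv : ∀ i, v i ∈ Q := fun i => Q.orderEmbOfFin_mem hQc i
    have hvi : Function.Injective v := (Q.orderEmbOfFin hQc).injective
    obtain ⟨w, hw, hwC⟩ := four_indices
      (fun i => I.filter (fun u => Q.erase (v i) ⊆ D u)) (fun i => hgood _ (hv i))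
    refine hQ w v hw hvi (fun i => (Finset.mem_filter.1 (hwC i)).1) ?_
    intro i j hij
    apply (Finset.mem_filter.1 (hwC i)).2
    rw [Finset.mem_erase]
    exact ⟨fun h => hij (hvi h).symm, hv j⟩
  have h1 : (D u).card.choose 4 ≤ B.card * (D u).card := by
    rw [← Finset.card_powersetCard]
    exact (Finset.card_le_card hsub).trans (Finset.card_image₂_le _ _ _)
  obtain ⟨e, he⟩ : ∃ e, (D u).card = e + 4 := ⟨(D u).card - 4, by omega⟩
  rw [he] at h1 ⊢
  have h2 : (e + 4) * (e + 3) * (e + 2) * (e + 1) = 24 * (e + 4).choose 4 := by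
    have := Nat.descFactorial_eq_factorial_mul_choose (e + 4) 4
    simp [Nat.descFactorial, Nat.factorial] at this
    nlinarith
  have h3 : (e + 4) ^ 3 * (e + 4) ≤ (256 * B.card) * (e + 4) := by
    have : 3 * (e + 4) ^ 4 ≤ 32 * ((e + 4) * (e + 3) * (e + 2) * (e + 1)) := by
      have : 3 * (e + 4) ^ 3 ≤ 32 * ((e + 3) * (e + 2) * (e + 1)) := by
        ring_nf; nlinarith [sq_nonneg e]
      nlinarith
    nlinarith
  exact Nat.le_of_mul_le_mul_right h3 (by omega)

lemma noQ {A : Finset ℕ} 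
    (hA : ∀ (a : Fin 12 → ℕ) (x : ℕ), (∀ i, a i ∈ A) → StrictMono a → 0 < x →
      (∏ i, a i) ≠ x ^ 3) (hA0 : ∀ m ∈ A, 1 ≤ m) (U : ℕ → ℕ) (D : ℕ → Finset ℕ)
    (hD : ∀ u, ∀ v ∈ D u, u * v ∈ A ∧ U (u * v) = u)
    (u v : Fin 4 → ℕ) (hu : Function.Injective u) (hv : Function.Injective v) :
    ¬ (∀ i j, i ≠ j → v j ∈ D (u i)) := by
  intro h
  let P : Finset (Fin 4 × Fin 4) := Finset.univ.filter (fun p => p.1 ≠ p.2)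
  have hP : P.card = 12 := by decide
  have hpos : ∀ i j, i ≠ j → 1 ≤ u i * v j := fun i j hij => hA0 _ (hD _ _ (h i j hij)).1
  have hinj : Set.InjOn (fun p : Fin 4 × Fin 4 => u p.1 * v p.2) P := by
    rintro ⟨i, j⟩ hij ⟨i', j'⟩ hij' he
    simp only [P, Finset.coe_filter, Finset.mem_univ, true_and, Set.mem_ofPred_eq, ne_eq] at hij hij' he
    have h1 := (hD _ _ (h i j hij)).2
    have h2 := (hD _ _ (h i' j' hij')).2
    rw [he, h2] at h1
    have hi := hu h1
    subst hi
    have h3 := hpos i' j hij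
    have : 0 < u i' := Nat.pos_of_ne_zero (by rintro h0; simp [h0] at h3)
    have := hv (Nat.eq_of_mul_eq_mul_left this he)
    rw [this]
  refine no_cube_finset hA (P.image (fun p => u p.1 * v p.2)) ?_ ?_
    ((∏ i, u i) * ∏ j, v j) ?_ ?_
  · intro m hm
    rw [Finset.mem_image] at hm
    obtain ⟨⟨i, j⟩, hp, rfl⟩ := hm
    exact (hD _ _ (h i j (by simpa [P] using hp))).1
  · rw [Finset.card_image_of_injOn hinj, hP]
  · apply Nat.mul_pos
    · apply Finset.prod_pos
      intro i _
      obtain ⟨j, hj⟩ : ∃ j : Fin 4, i ≠ j := by revert i; decide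
      have := hpos i j hj
      exact Nat.pos_of_ne_zero (by rintro h0; simp [h0] at this)
    · apply Finset.prod_pos
      intro i _
      obtain ⟨j, hj⟩ : ∃ j : Fin 4, j ≠ i := by revert i; decide
      have := hpos j i hj
      exact Nat.pos_of_ne_zero (by rintro h0; simp [h0] at this)
  · rw [Finset.prod_image hinj]
    simp only [P, Finset.prod_filter, Fintype.prod_prod_type, Fin.prod_univ_four]
    simp
    ring

lemma sum_powersetCard_prod_le (w : ℕ → ℝ) (hw : ∀ i, 0 ≤ w i) (S : Finset ℕ) :
    ∀ k : ℕ, ∑ t ∈ S.powersetCard k, ∏ i ∈ t, w i ≤ (∑ i ∈ S, w i) ^ k := by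
  induction S using Finset.induction_on with
  | empty =>
    intro k
    cases k with
    | zero => simp
    | succ k => rw [Finset.powersetCard_eq_empty.2 (by simp)]; simp
  | insert x S hx ih =>
    intro k
    cases k with
    | zero => simp
    | succ k =>
      have hs : 0 ≤ ∑ i ∈ S, w i := Finset.sum_nonneg (fun i _ => hw i)
      rw [Finset.powersetCard_succ_insert hx, Finset.sum_union, Finset.sum_insert hx,
        Finset.sum_image]
      · have : ∑ t ∈ S.powersetCard k, ∏ i ∈ insert x t, w i
            = w x * ∑ t ∈ S.powersetCard k, ∏ i ∈ t, w i := by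
          rw [Finset.mul_sum]
          refine Finset.sum_congr rfl fun t ht => ?_
          rw [Finset.prod_insert]
          intro h
          exact hx ((Finset.mem_powersetCard.1 ht).1 h)
        rw [this]
        have h1 := ih k
        have h2 := ih (k+1)
        have h3 := hw x
        calc _ ≤ (∑ i ∈ S, w i) ^ (k+1) + w x * (∑ i ∈ S, w i) ^ k := by gcongr
          _ = (w x + ∑ i ∈ S, w i) * (∑ i ∈ S, w i) ^ k := by ring
          _ ≤ (w x + ∑ i ∈ S, w i) * (w x + ∑ i ∈ S, w i) ^ k := by gcongr; linarith
          _ = _ := by ring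
      · intro a ha b hb hab
        have hxa : x ∉ a := fun h => hx ((Finset.mem_powersetCard.1 ha).1 h)
        have hxb : x ∉ b := fun h => hx ((Finset.mem_powersetCard.1 hb).1 h)
        rw [← Finset.erase_insert hxa, ← Finset.erase_insert hxb, hab]
      · rw [Finset.disjoint_left]
        intro t ht ht'
        rw [Finset.mem_image] at ht'
        obtain ⟨b, _, rfl⟩ := ht'
        exact hx ((Finset.mem_powersetCard.1 ht).1 (Finset.mem_insert_self _ _))

lemma sum_rpow_small (M : ℕ) :
    ∑ a ∈ Finset.Icc 1 M, (a : ℝ) ^ (-(8:ℝ)/9) ≤ 9 * (M : ℝ) ^ ((1:ℝ)/9) := by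
  induction M with
  | zero => simp
  | succ M ih =>
    rw [Finset.sum_Icc_succ_top (by omega)]
    push_cast
    set x : ℝ := (M : ℝ) + 1 with hx
    have hM : (0:ℝ) ≤ M := Nat.cast_nonneg M
    have hx1 : 1 ≤ x := by linarith
    have hx0 : 0 < x := by linarith
    have hinv : 1 / x ≤ 1 := by rw [div_le_one hx0]; exact hx1
    have hb := rpow_one_add_le_one_add_mul_self (s := -(1/x)) (by linarith)
      (p := 1/9) (by norm_num) (by norm_num)
    have h1 : (M : ℝ) = x * (1 + -(1/x)) := by field_simp; linarith
    have h2 : x ^ (-(8:ℝ)/9) = x ^ ((1:ℝ)/9) * (1/x) := by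
      rw [one_div x, ← Real.rpow_neg_one x, ← Real.rpow_add hx0]; norm_num
    have h3 : (M:ℝ) ^ ((1:ℝ)/9) = x ^ ((1:ℝ)/9) * (1 + -(1/x)) ^ ((1:ℝ)/9) := by
      conv_lhs => rw [h1]
      rw [Real.mul_rpow hx0.le (by linarith)]
    have h4 : 0 < x ^ ((1:ℝ)/9) := by positivity
    rw [h3] at ih
    rw [h2]
    nlinarith

lemma sum_rpow_tail (s : ℝ) (hs : 0 < s) (M : ℕ) :
    ∑ a ∈ Finset.Icc 1 M, ((a : ℝ) + s) ^ (-(4:ℝ)/3)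
      ≤ 3 * (s ^ (-(1:ℝ)/3) - ((M : ℝ) + s) ^ (-(1:ℝ)/3)) := by
  induction M with
  | zero => simp
  | succ M ih =>
    rw [Finset.sum_Icc_succ_top (by omega)]
    push_cast
    have hM : (0:ℝ) ≤ M := Nat.cast_nonneg M
    set x : ℝ := (M : ℝ) + 1 + s with hx
    have hx1 : 1 < x := by linarith
    have hx0 : 0 < x := by linarith
    have hinv : 1 / x < 1 := by rw [div_lt_one hx0]; exact hx1
    have hinv0 : 0 < 1 / x := by positivity
    have hb := rpow_one_add_le_one_add_mul_self (s := -(1/x)) (by linarith)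
      (p := 1/3) (by norm_num) (by norm_num)
    have h1 : (M : ℝ) + s = x * (1 + -(1/x)) := by field_simp; linarith
    have h2 : x ^ (-(4:ℝ)/3) = x ^ (-(1:ℝ)/3) * (1/x) := by
      rw [one_div x, ← Real.rpow_neg_one x, ← Real.rpow_add hx0]; norm_num
    have hp : 0 < (1 + -(1/x)) := by linarith
    have h3 : ((M:ℝ) + s) ^ (-(1:ℝ)/3) = x ^ (-(1:ℝ)/3) * ((1 + -(1/x)) ^ ((1:ℝ)/3))⁻¹ := by
      rw [h1, Real.mul_rpow hx0.le hp.le, ← Real.rpow_neg hp.le]; norm_num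
    have h4 : 0 < x ^ (-(1:ℝ)/3) := by positivity
    have h5 : 1 + 1 / 3 * (1/x) ≤ ((1 + -(1/x)) ^ ((1:ℝ)/3))⁻¹ := by
      have hq : 0 < (1 + -(1/x)) ^ ((1:ℝ)/3) := by positivity
      rw [le_inv_comm₀ (by positivity) hq]
      refine hb.trans ?_
      rw [← one_div, le_div_iff₀ (by positivity)]
      nlinarith
    rw [h3] at ih
    rw [h2]
    nlinarith

lemma weight_bound (n u : ℕ) (s : ℝ) (t : Finset ℕ) (ht : t.card = 3)
    (h1 : ∀ a ∈ t, 1 ≤ a) (h2 : ∀ a ∈ t, u * a ≤ n) (h3 : ∀ a ∈ t, s * a ≤ n) (hs : 0 ≤ s) :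
    ((u : ℝ) + s) ^ ((8:ℝ)/3) ≤ (2 * n : ℝ) ^ ((8:ℝ)/3) * ∏ a ∈ t, (a : ℝ) ^ (-(8:ℝ)/9) := by
  have key : ∀ a ∈ t, ((u : ℝ) + s) ^ ((8:ℝ)/9) ≤ (2 * n : ℝ) ^ ((8:ℝ)/9) * (a : ℝ) ^ (-(8:ℝ)/9) := by
    intro a ha
    have ha1 : (1:ℝ) ≤ a := by exact_mod_cast h1 a ha
    have ha2 : (u:ℝ) * a ≤ n := by exact_mod_cast h2 a ha
    have ha3 := h3 a ha
    have : (a:ℝ) ^ (-(8:ℝ)/9) = ((a:ℝ)⁻¹) ^ ((8:ℝ)/9) := by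
      rw [Real.inv_rpow (by linarith), ← Real.rpow_neg (by linarith)]; norm_num
    rw [this, ← Real.mul_rpow (by positivity) (by positivity)]
    apply Real.rpow_le_rpow (by positivity) _ (by norm_num)
    rw [← div_eq_mul_inv, le_div_iff₀ (by linarith)]
    linarith
  have := Finset.prod_le_prod (s := t) (fun a _ => by positivity) key
  rw [Finset.prod_mul_distrib, Finset.prod_const, Finset.prod_const, ht,
    ← Real.rpow_natCast, ← Real.rpow_natCast, ← Real.rpow_mul (by positivity),
    ← Real.rpow_mul (by positivity)] at this
  norm_num at this ⊢
  exact this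

lemma prime_main (n : ℕ) : ∑ u ∈ (Finset.Icc 1 n).filter Nat.Prime, min 3 (n / u)
    ≤ n.primeCounting + (n / 2).primeCounting + (n / 3).primeCounting := by
  have hc : ∀ k, 1 ≤ k → ∑ u ∈ (Finset.Icc 1 n).filter Nat.Prime, (if u ≤ n / k then 1 else 0)
      = (n / k).primeCounting := by
    intro k hk
    rw [← Nat.primesLE_card_eq_primeCounting, Finset.sum_boole, Finset.filter_filter]
    simp only [Nat.cast_id]
    congr 1
    ext p
    have := Nat.div_le_self n k
    simp only [Finset.mem_filter, Finset.mem_Icc, Nat.mem_primesLE]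
    constructor
    · rintro ⟨_, h, h'⟩; exact ⟨h', h⟩
    · rintro ⟨h, h'⟩; exact ⟨⟨h'.one_lt.le, by omega⟩, h', h⟩
  have h1 := hc 1 le_rfl
  rw [Nat.div_one] at h1
  rw [← h1, ← hc 2 (by norm_num), ← hc 3 (by norm_num), ← Finset.sum_add_distrib,
    ← Finset.sum_add_distrib]
  apply Finset.sum_le_sum
  intro u hu
  simp only [Finset.mem_filter, Finset.mem_Icc] at hu
  have hu0 : 0 < u := by omega
  have e2 : u ≤ n / 2 ↔ 2 ≤ n / u := by
    rw [Nat.le_div_iff_mul_le (by norm_num), Nat.le_div_iff_mul_le hu0, mul_comm]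
  have e3 : u ≤ n / 3 ↔ 3 ≤ n / u := by
    rw [Nat.le_div_iff_mul_le (by norm_num), Nat.le_div_iff_mul_le hu0, mul_comm]
  rw [if_pos hu.1.2]
  simp only [e2, e3]
  split_ifs <;> omega

lemma upper_bound_s12 (n : ℕ) (hn : 1 ≤ n) (A : Finset ℕ) (hAn : A ⊆ Finset.Icc 1 n)
    (hA : ∀ (a : Fin 12 → ℕ) (x : ℕ), (∀ i, a i ∈ A) → StrictMono a → 0 < x →
      (∏ i, a i) ≠ x ^ 3) :
    (A.card : ℝ) ≤ (Nat.primeCounting n : ℝ) + (Nat.primeCounting (n / 2) : ℝ)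
            + (Nat.primeCounting (n / 3) : ℝ) + 5000000 * (n : ℝ) ^ ((5 : ℝ)/6) := by
  have hA1 : ∀ m ∈ A, 1 ≤ m := fun m hm => (Finset.mem_Icc.1 (hAn hm)).1
  have hA2 : ∀ m ∈ A, m ≤ n := fun m hm => (Finset.mem_Icc.1 (hAn hm)).2
  have hdec : ∀ m, ∃ u v, m ∈ A → u * v = m ∧ v ^ 2 ≤ n ∧ (u.Prime ∨ u ^ 4 ≤ n ^ 3) := by
    intro m
    by_cases hm : m ∈ A
    · obtain ⟨u, v, h⟩ := exists_decomp n m (hA1 m hm) (hA2 m hm)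
      exact ⟨u, v, fun _ => h⟩
    · exact ⟨0, 0, fun h => absurd h hm⟩
  choose U V hUV using hdec
  set D : ℕ → Finset ℕ := fun u => (A.filter (fun m => U m = u)).image V with hDdef
  have hD : ∀ u, ∀ v ∈ D u, u * v ∈ A ∧ U (u * v) = u ∧ v ^ 2 ≤ n ∧ (u.Prime ∨ u ^ 4 ≤ n ^ 3) := by
    intro u v hv
    simp only [hDdef, Finset.mem_image, Finset.mem_filter] at hv
    obtain ⟨m, ⟨hm, hu⟩, hvv⟩ := hv
    have := hUV m hm
    rw [hu, hvv] at this
    rw [this.1]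
    exact ⟨hm, hu, this.2.1, this.2.2⟩
  have hDcard : ∀ u, (D u).card = (A.filter (fun m => U m = u)).card := by
    intro u
    apply Finset.card_image_of_injOn
    intro m hm m' hm' he
    simp only [Finset.coe_filter, Set.mem_ofPred_eq] at hm hm'
    rw [← (hUV m hm.1).1, ← (hUV m' hm'.1).1, hm.2, hm'.2, he]
  have hDpos : ∀ u, ∀ v ∈ D u, 1 ≤ v ∧ u * v ≤ n := by
    intro u v hv
    have h := (hD u v hv).1
    refine ⟨?_, hA2 _ h⟩
    have := hA1 _ h
    exact Nat.pos_of_ne_zero (by rintro h0; simp [h0] at this)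
  set I := Finset.Icc 1 n with hI
  have hUmem : ∀ m ∈ A, U m ∈ I := by
    intro m hm
    have h := (hUV m hm).1
    have h1 := hA1 m hm
    have h2 := hA2 m hm
    have h3 : U m ∣ m := ⟨V m, h.symm⟩
    rw [hI, Finset.mem_Icc]
    exact ⟨Nat.pos_of_dvd_of_pos h3 h1, (Nat.le_of_dvd h1 h3).trans h2⟩
  have hAcard : A.card = ∑ u ∈ I, (D u).card := by
    rw [Finset.card_eq_sum_card_fiberwise (f := U) (t := I) hUmem]
    exact Finset.sum_congr rfl fun u _ => (hDcard u).symm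
  have hbad := bad_count I D (fun u v hu hv _ => noQ hA hA1 U D
    (fun u v hv => ⟨(hD u v hv).1, (hD u v hv).2.1⟩) u v hu hv)
  set bad : Finset ℕ → Prop := fun t => (I.filter (fun u => t ⊆ D u)).card ≤ 3 with hbaddef
  set s : ℝ := Real.sqrt n with hs
  have hn0 : (0:ℝ) < n := by exact_mod_cast hn
  have hs0 : 0 < s := Real.sqrt_pos.2 hn0
  have hss : s * s = n := Real.mul_self_sqrt hn0.le
  set T : ℕ → ℝ := fun u => n * ((u:ℝ) + s) ^ (-(4:ℝ)/3) with hT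
  have hTpos : ∀ u, 0 < T u := fun u => by
    have : (0:ℝ) ≤ u := Nat.cast_nonneg u
    simp only [hT]; positivity
  have hTinv : ∀ u, 1 / (T u) ^ 2 = ((u:ℝ) + s) ^ ((8:ℝ)/3) / (n:ℝ)^2 := by
    intro u
    have : (0:ℝ) ≤ u := Nat.cast_nonneg u
    have h0 : 0 < (u:ℝ) + s := by linarith
    simp only [hT]
    rw [mul_pow, ← Real.rpow_natCast (((u:ℝ) + s) ^ (-(4:ℝ)/3)), ← Real.rpow_mul h0.le]
    have : ((u:ℝ) + s) ^ ((8:ℝ)/3) = (((u:ℝ) + s) ^ (-(4:ℝ)/3 * ((2:ℕ):ℝ)))⁻¹ := by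
      rw [← Real.rpow_neg h0.le]; norm_num
    rw [this]
    field_simp
  set W : Finset ℕ → ℝ := fun t => ∏ a ∈ t, (a : ℝ) ^ (-(8:ℝ)/9) with hW
  have hW0 : ∀ t, 0 ≤ W t := fun t => Finset.prod_nonneg (fun a _ => by positivity)
  set K : ℝ := (2 * n : ℝ) ^ ((8:ℝ)/3) / (n:ℝ)^2 with hK
  have hK0 : 0 ≤ K := by positivity
  -- pointwise bound
  have hpt : ∀ u ∈ I, ((D u).card : ℝ) ≤
      (if u.Prime then ((min 3 (n / u) : ℕ) : ℝ) else 0) + (if u ^ 4 ≤ n ^ 3 then 3 else 0)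
      + T u + 256 * K * ∑ t ∈ (D u).powersetCard 3 with bad t, W t := by
    intro u hu
    have hsum0 : 0 ≤ ∑ t ∈ (D u).powersetCard 3 with bad t, W t :=
      Finset.sum_nonneg fun t _ => hW0 t
    have hlast : 0 ≤ 256 * K * ∑ t ∈ (D u).powersetCard 3 with bad t, W t := by positivity
    have ha : (0:ℝ) ≤ (if u.Prime then ((min 3 (n / u) : ℕ) : ℝ) else 0) := by
      split_ifs <;> positivity
    have hb : (0:ℝ) ≤ (if u ^ 4 ≤ n ^ 3 then 3 else 0) := by split_ifs <;> positivity
    have hTu := hTpos u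
    rw [hI, Finset.mem_Icc] at hu
    have hdn : (D u).card ≤ n / u := by
      have : D u ⊆ Finset.Icc 1 (n / u) := by
        intro v hv
        have := hDpos u v hv
        rw [Finset.mem_Icc]
        refine ⟨this.1, ?_⟩
        rw [Nat.le_div_iff_mul_le (by omega), mul_comm]; exact this.2
      simpa using Finset.card_le_card this
    by_cases h4 : 4 ≤ (D u).card
    · have h5 := hbad u h4
      have h5' : ((D u).card : ℝ) ^ 3 ≤ 256 * (((D u).powersetCard 3).filter bad).card := by
        exact_mod_cast h5
      have h6 : (((D u).powersetCard 3).filter bad).card * (1 / (T u)^2)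
          ≤ K * ∑ t ∈ (D u).powersetCard 3 with bad t, W t := by
        rw [Finset.mul_sum, ← nsmul_eq_mul, ← Finset.sum_const]
        apply Finset.sum_le_sum
        intro t ht
        rw [Finset.mem_filter, Finset.mem_powersetCard] at ht
        rw [hTinv, hK, div_mul_eq_mul_div]
        apply div_le_div_of_nonneg_right _ (by positivity)
        apply weight_bound n u s t ht.1.2
        · intro a ha; exact (hDpos u a (ht.1.1 ha)).1
        · intro a ha; exact (hDpos u a (ht.1.1 ha)).2
        · intro a ha
          have h7 := (hD u a (ht.1.1 ha)).2.2.1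
          have h8 : (a:ℝ) ≤ s := Real.le_sqrt_of_sq_le (by exact_mod_cast h7)
          nlinarith
        · exact hs0.le
      have h9 : ((D u).card : ℝ) ≤ T u + ((D u).card : ℝ)^3 * (1 / (T u)^2) := by
        by_cases hc : ((D u).card : ℝ) ≤ T u
        · have : 0 ≤ ((D u).card : ℝ)^3 * (1 / (T u)^2) := by positivity
          linarith
        · push Not at hc
          have : ((D u).card : ℝ) ≤ ((D u).card : ℝ)^3 * (1 / (T u)^2) := by
            rw [mul_one_div, le_div_iff₀ (by positivity)]
            have : (T u)^2 ≤ ((D u).card : ℝ)^2 := by gcongr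
            have h0 : (0:ℝ) ≤ (D u).card := Nat.cast_nonneg _
            nlinarith
          linarith
      have h10 : ((D u).card : ℝ)^3 * (1 / (T u)^2) ≤
          256 * (((D u).powersetCard 3).filter bad).card * (1 / (T u)^2) := by
        gcongr
      nlinarith
    · rcases (D u).eq_empty_or_nonempty with h0 | ⟨v, hv⟩
      · rw [h0]
        simp only [h0, Finset.card_empty, Nat.cast_zero] at hlast ⊢
        linarith
      · rcases (hD u v hv).2.2.2 with hp | hp
        · rw [if_pos hp]
          have : (((D u).card : ℕ) : ℝ) ≤ ((min 3 (n / u) : ℕ) : ℝ) := by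
            exact_mod_cast (le_min (by omega) hdn)
          linarith
        · rw [if_pos hp]
          have : (((D u).card : ℕ) : ℝ) ≤ ((3 : ℕ) : ℝ) := by
            exact_mod_cast (by omega : (D u).card ≤ 3)
          push_cast at this
          linarith
  have hsumall := Finset.sum_le_sum hpt
  rw [Finset.sum_add_distrib, Finset.sum_add_distrib, Finset.sum_add_distrib] at hsumall
  have hs1 : ∑ u ∈ I, (if u.Prime then ((min 3 (n / u) : ℕ) : ℝ) else 0)
      ≤ (Nat.primeCounting n : ℝ) + (Nat.primeCounting (n / 2) : ℝ)
            + (Nat.primeCounting (n / 3) : ℝ) := by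
    rw [← Finset.sum_filter]
    exact_mod_cast prime_main n
  set X : ℝ := (n:ℝ) ^ ((5:ℝ)/6) with hX
  have hn1 : (1:ℝ) ≤ n := by exact_mod_cast hn
  have hs2 : ∑ u ∈ I, (if u ^ 4 ≤ n ^ 3 then (3:ℝ) else 0) ≤ 3 * X := by
    rw [← Finset.sum_filter, Finset.sum_const, nsmul_eq_mul, mul_comm]
    have hsub : I.filter (fun u => u ^ 4 ≤ n ^ 3) ⊆ Finset.Icc 1 ⌊X⌋₊ := by
      intro u hu
      rw [Finset.mem_filter, hI, Finset.mem_Icc] at hu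
      rw [Finset.mem_Icc]
      refine ⟨hu.1.1, Nat.le_floor ?_⟩
      have h1 : (u:ℝ) ^ 4 ≤ (n:ℝ) ^ 3 := by exact_mod_cast hu.2
      have h2 : (u:ℝ) = ((u:ℝ) ^ 4) ^ ((1:ℝ)/4) := by
        rw [← Real.rpow_natCast, ← Real.rpow_mul (Nat.cast_nonneg _)]; norm_num
      rw [h2]
      calc ((u:ℝ) ^ 4) ^ ((1:ℝ)/4) ≤ ((n:ℝ) ^ 3) ^ ((1:ℝ)/4) := by gcongr
        _ = (n:ℝ) ^ ((3:ℝ)/4) := by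
          rw [← Real.rpow_natCast, ← Real.rpow_mul (Nat.cast_nonneg _)]; norm_num
        _ ≤ X := Real.rpow_le_rpow_of_exponent_le hn1 (by norm_num)
    have h := Finset.card_le_card hsub
    rw [Nat.card_Icc, Nat.add_sub_cancel] at h
    have h3 : ((I.filter (fun u => u ^ 4 ≤ n ^ 3)).card : ℝ) ≤ (⌊X⌋₊ : ℝ) := by exact_mod_cast h
    have h4 : (⌊X⌋₊ : ℝ) ≤ X := Nat.floor_le (by positivity)
    linarith
  have hs3 : ∑ u ∈ I, T u ≤ 3 * X := by
    simp only [hT]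
    rw [← Finset.mul_sum]
    have h1 := sum_rpow_tail s hs0 n
    have h2 : (0:ℝ) ≤ ((n : ℝ) + s) ^ (-(1:ℝ)/3) := by positivity
    have h3 : X = n * s ^ (-(1:ℝ)/3) := by
      rw [hX, hs, Real.sqrt_eq_rpow, ← Real.rpow_mul hn0.le]
      nth_rewrite 2 [← Real.rpow_one (n:ℝ)]
      rw [← Real.rpow_add hn0]; norm_num
    rw [h3]
    nlinarith
  have hs4 : ∑ u ∈ I, ∑ t ∈ (D u).powersetCard 3 with bad t, W t ≤ 2187 * (n:ℝ) ^ ((1:ℝ)/6) := by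
    set M := Nat.sqrt n with hM
    set P := (Finset.Icc 1 M).powersetCard 3 with hP
    have hDM : ∀ u, D u ⊆ Finset.Icc 1 M := by
      intro u v hv
      rw [Finset.mem_Icc]
      refine ⟨(hDpos u v hv).1, ?_⟩
      rw [hM, Nat.le_sqrt']
      exact (hD u v hv).2.2.1
    have e1 : ∀ u ∈ I, ∑ t ∈ (D u).powersetCard 3 with bad t, W t
        = ∑ t ∈ P, if (t ⊆ D u ∧ bad t) then W t else 0 := by
      intro u _
      rw [← Finset.sum_filter]
      apply Finset.sum_congr _ fun _ _ => rfl
      ext t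
      simp only [Finset.mem_filter, Finset.mem_powersetCard, hP]
      constructor
      · rintro ⟨⟨h1, h2⟩, h3⟩
        exact ⟨⟨h1.trans (hDM u), h2⟩, h1, h3⟩
      · rintro ⟨⟨h1, h2⟩, h3, h4⟩
        exact ⟨⟨h3, h2⟩, h4⟩
    rw [Finset.sum_congr rfl e1, Finset.sum_comm]
    have e2 : ∀ t ∈ P, ∑ u ∈ I, (if (t ⊆ D u ∧ bad t) then W t else 0) ≤ 3 * W t := by
      intro t _
      by_cases hb : bad t
      · simp only [hb, and_true]
        rw [← Finset.sum_filter, Finset.sum_const, nsmul_eq_mul]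
        have : ((I.filter (fun u => t ⊆ D u)).card : ℝ) ≤ 3 := by exact_mod_cast hb
        exact mul_le_mul_of_nonneg_right this (hW0 t)
      · simp only [hb, and_false, if_false, Finset.sum_const_zero]
        have := hW0 t
        positivity
    refine (Finset.sum_le_sum e2).trans ?_
    rw [← Finset.mul_sum]
    have e3 := sum_powersetCard_prod_le (fun a => (a:ℝ) ^ (-(8:ℝ)/9)) (fun a => by positivity)
      (Finset.Icc 1 M) 3
    have e4 := sum_rpow_small M
    have e5 : (M:ℝ) ≤ s := Real.nat_sqrt_le_real_sqrt
    have e6 : (9 * (M : ℝ) ^ ((1:ℝ)/9)) ^ 3 ≤ 729 * (n:ℝ) ^ ((1:ℝ)/6) := by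
      calc (9 * (M : ℝ) ^ ((1:ℝ)/9)) ^ 3 ≤ (9 * s ^ ((1:ℝ)/9)) ^ 3 := by gcongr
        _ = 729 * (n:ℝ) ^ ((1:ℝ)/6) := by
          rw [mul_pow, hs, Real.sqrt_eq_rpow, ← Real.rpow_mul hn0.le, ← Real.rpow_natCast _ 3, 
            ← Real.rpow_natCast _ 3, ← Real.rpow_mul hn0.le]
          norm_num
    have e7 : (∑ i ∈ Finset.Icc 1 M, (i:ℝ) ^ (-(8:ℝ)/9)) ^ 3 ≤ (9 * (M : ℝ) ^ ((1:ℝ)/9)) ^ 3 := by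
      apply pow_le_pow_left₀ _ e4
      exact Finset.sum_nonneg fun _ _ => by positivity
    have e8 : ∑ t ∈ P, W t ≤ 729 * (n:ℝ) ^ ((1:ℝ)/6) := e3.trans (e7.trans e6)
    linarith
  have hKn : K * (n:ℝ) ^ ((1:ℝ)/6) ≤ 8 * X := by
    have k1 : (2 * n : ℝ) ^ ((8:ℝ)/3) = (2:ℝ) ^ ((8:ℝ)/3) * (n:ℝ) ^ ((8:ℝ)/3) :=
      Real.mul_rpow (by norm_num) hn0.le
    have k2 : (2:ℝ) ^ ((8:ℝ)/3) ≤ 8 := by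
      calc (2:ℝ) ^ ((8:ℝ)/3) ≤ (2:ℝ) ^ (3:ℝ) :=
            Real.rpow_le_rpow_of_exponent_le (by norm_num) (by norm_num)
        _ = 8 := by norm_num
    have k3 : (n:ℝ) ^ ((8:ℝ)/3) * (n:ℝ) ^ ((1:ℝ)/6) = X * (n:ℝ)^2 := by
      rw [hX, ← Real.rpow_natCast (n:ℝ) 2, ← Real.rpow_add hn0, ← Real.rpow_add hn0]
      norm_num
    have hX0 : 0 ≤ X := by positivity
    rw [hK, k1, div_mul_eq_mul_div, mul_assoc, k3, div_le_iff₀ (by positivity)]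
    have : 0 ≤ X * (n:ℝ)^2 := by positivity
    nlinarith
  have hfin : ∑ u ∈ I, 256 * K * ∑ t ∈ (D u).powersetCard 3 with bad t, W t
      ≤ 256 * 2187 * 8 * X := by
    rw [← Finset.mul_sum]
    calc 256 * K * ∑ u ∈ I, ∑ t ∈ (D u).powersetCard 3 with bad t, W t
        ≤ 256 * K * (2187 * (n:ℝ) ^ ((1:ℝ)/6)) := by gcongr
      _ = 256 * 2187 * (K * (n:ℝ) ^ ((1:ℝ)/6)) := by ring
      _ ≤ 256 * 2187 * (8 * X) := by gcongr
      _ = _ := by ring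
  have hX0 : 0 ≤ X := by positivity
  rw [hAcard]
  push_cast
  linarith

lemma c4_small {α β : Type*} [DecidableEq α] [DecidableEq β] (E : Finset (α × β))
    (hC4 : ∀ a a' b b', (a, b) ∈ E → (a, b') ∈ E → (a', b) ∈ E → (a', b') ∈ E → a = a' ∨ b = b')
    (h1 : ∀ e ∈ E, 3 ≤ (E.filter (fun e' => e'.1 = e.1)).card)
    (h2 : ∀ e ∈ E, 3 ≤ (E.filter (fun e' => e'.2 = e.2)).card)
    (hc : E.card ≤ 12) : E = ∅ := by
  by_contra hne
  obtain ⟨⟨a, b⟩, he⟩ := Finset.nonempty_iff_ne_empty.2 hne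
  obtain ⟨⟨a', b'⟩, he', hnee⟩ := Finset.exists_mem_ne (s := E.filter (fun e' => e'.1 = a))
    (by have := h1 _ he; simp only at this; omega) (a, b)
  rw [Finset.mem_filter] at he'
  obtain ⟨he', haa⟩ := he'
  simp only at haa
  subst haa
  have hbb : b' ≠ b := fun h => hnee (by rw [h])
  have hX : ∀ c, (a', c) ∈ E → 3 ≤ ((E.filter (fun e' => e'.2 = c)).image Prod.fst).card := by
    intro c hcE
    rw [Finset.card_image_of_injOn]
    · exact h2 _ hcE
    · rintro ⟨x, y⟩ hx ⟨x', y'⟩ hx' h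
      simp only [Finset.coe_filter, Set.mem_ofPred_eq] at hx hx' h
      rw [h, hx.2, hx'.2]
  have hX1 := hX b he
  have hX2 := hX b' he'
  set X1 := (E.filter (fun e' => e'.2 = b)).image Prod.fst with hX1d
  set X2 := (E.filter (fun e' => e'.2 = b')).image Prod.fst with hX2d
  have hint : (X1 ∩ X2).card ≤ 1 := by
    rw [Finset.card_le_one]
    have : ∀ x ∈ X1 ∩ X2, x = a' := by
      intro x hx
      simp only [hX1d, hX2d, Finset.mem_inter, Finset.mem_image, Finset.mem_filter, Prod.exists,
        exists_and_right, exists_eq_right] at hx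
      obtain ⟨hy, hz⟩ := hx
      rcases hC4 x a' b b' hy hz he he' with h | h
      · exact h
      · exact absurd h.symm hbb
    intro x hx y hy
    rw [this x hx, this y hy]
  have hun := Finset.card_union_add_card_inter X1 X2
  have hsub : X1 ∪ X2 ⊆ E.image Prod.fst :=
    Finset.union_subset (Finset.image_subset_image (Finset.filter_subset _ _))
      (Finset.image_subset_image (Finset.filter_subset _ _))
  have h5 := Finset.card_le_card hsub
  have h6 : (E.image Prod.fst).card * 3 ≤ E.card := by
    rw [Finset.card_eq_sum_card_image Prod.fst E, ← smul_eq_mul]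
    apply Finset.card_nsmul_le_sum
    intro x hx
    rw [Finset.mem_image] at hx
    obtain ⟨e, he, rfl⟩ := hx
    exact h1 e he
  omega

lemma three_dvd_count_s12 (S : Finset ℕ) (hsq : ∀ m ∈ S, Squarefree m) (x : ℕ)
    (hx : ∏ m ∈ S, m = x ^ 3) (r : ℕ) (hr : r.Prime) :
    3 ∣ (S.filter (fun m => r ∣ m)).card := by
  have h0 : ∀ m ∈ S, m ≠ 0 := fun m hm => (hsq m hm).ne_zero
  have h := congrArg (fun k => k.factorization r) hx
  simp only [Nat.factorization_pow] at h
  rw [Nat.factorization_prod h0] at h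
  simp only [Finsupp.coe_finsetSum, Finset.sum_apply, Finsupp.smul_apply, smul_eq_mul] at h
  rw [Finset.card_filter]
  refine ⟨x.factorization r, ?_⟩
  rw [← h]
  apply Finset.sum_congr rfl
  intro m hm
  have h1 := Squarefree.natFactorization_le_one r (hsq m hm)
  split_ifs with hd
  · have := (hr.dvd_iff_one_le_factorization (h0 m hm)).1 hd
    omega
  · exact (Nat.factorization_eq_zero_of_not_dvd hd).symm

lemma no_cube_construction {α β : Type*} [DecidableEq α] [DecidableEq β] (G : Finset (α × β))
    (hC4 : ∀ a a' b b', (a, b) ∈ G → (a, b') ∈ G → (a', b) ∈ G → (a', b') ∈ G → a = a' ∨ b = b')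
    (s : ℕ) (hs : 3 ≤ s) (f : α ⊕ β → ℕ) (hf : Function.Injective f)
    (hfp : ∀ c, (f c).Prime) (hf3 : ∀ c, 3 < f c) (hfs : ∀ c, f c ≤ s)
    (S : Finset ℕ)
    (hS : ∀ m ∈ S, (∃ p i, p.Prime ∧ s < p ∧ (i = 1 ∨ i = 2 ∨ i = 3) ∧ m = i * p) ∨
      ∃ e ∈ G, m = f (Sum.inl e.1) * f (Sum.inr e.2))
    (hcard : S.card = 12) (x : ℕ) (hx : ∏ m ∈ S, m = x ^ 3) : False := by
  have hlr : ∀ a b, f (Sum.inl a) ≠ f (Sum.inr b) := fun a b h => by simpa using hf h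
  have hpd : ∀ p i r : ℕ, p.Prime → s < p → (i = 1 ∨ i = 2 ∨ i = 3) → r.Prime → 3 < r →
      r ∣ i * p → r = p := by
    intro p i r hp hsp hi hr hr3 hd
    rcases hr.dvd_mul.1 hd with h | h
    · have := Nat.le_of_dvd (by omega) h
      omega
    · exact (Nat.prime_dvd_prime_iff_eq hr hp).1 h
  have hvd : ∀ (e : α × β) (r : ℕ), r.Prime → r ∣ f (Sum.inl e.1) * f (Sum.inr e.2) →
      r = f (Sum.inl e.1) ∨ r = f (Sum.inr e.2) := by
    intro e r hr hd
    rcases hr.dvd_mul.1 hd with h | h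
    · exact Or.inl ((Nat.prime_dvd_prime_iff_eq hr (hfp _)).1 h)
    · exact Or.inr ((Nat.prime_dvd_prime_iff_eq hr (hfp _)).1 h)
  have hsq : ∀ m ∈ S, Squarefree m := by
    intro m hm
    rcases hS m hm with ⟨p, i, hp, hsp, hi, rfl⟩ | ⟨e, he, rfl⟩
    · rw [Nat.squarefree_mul]
      · refine ⟨?_, hp.squarefree⟩
        rcases hi with rfl | rfl | rfl
        · exact squarefree_one
        · exact Nat.prime_two.squarefree
        · exact Nat.prime_three.squarefree
      · apply Nat.Coprime.symm
        rw [hp.coprime_iff_not_dvd]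
        intro h
        have := Nat.le_of_dvd (by omega) h
        omega
    · rw [Nat.squarefree_mul]
      · exact ⟨(hfp _).squarefree, (hfp _).squarefree⟩
      · exact (Nat.coprime_primes (hfp _) (hfp _)).2 (hlr _ _)
  have h3 := three_dvd_count_s12 S hsq x hx
  -- the edge part
  set val : α × β → ℕ := fun e => f (Sum.inl e.1) * f (Sum.inr e.2) with hval
  have hvinj : Function.Injective val := by
    rintro ⟨a, b⟩ ⟨a', b'⟩ h
    have h1 : f (Sum.inl a) ∣ val (a', b') := by rw [← h]; exact ⟨_, rfl⟩
    have h2 : f (Sum.inr b) ∣ val (a', b') := by rw [← h]; exact ⟨_, mul_comm _ _⟩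
    rcases hvd _ _ (hfp _) h1 with h1 | h1
    · rcases hvd _ _ (hfp _) h2 with h2 | h2
      · exact absurd h2.symm (hlr _ _)
      · have e1 := hf h1
        have e2 := hf h2
        simp at e1 e2
        rw [e1, e2]
    · exact absurd h1 (hlr _ _)
  set E := G.filter (fun e => val e ∈ S) with hE
  have hEim : E.image val ⊆ S := by
    intro m hm
    rw [Finset.mem_image] at hm
    obtain ⟨e, he, rfl⟩ := hm
    exact (Finset.mem_filter.1 he).2
  have hEcard : E.card ≤ 12 := by
    rw [← hcard, ← Finset.card_image_of_injective E hvinj]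
    exact Finset.card_le_card hEim
  have hdeg1 : ∀ e ∈ E, 3 ≤ (E.filter (fun e' => e'.1 = e.1)).card := by
    intro e he
    have h : S.filter (fun m => f (Sum.inl e.1) ∣ m) = (E.filter (fun e' => e'.1 = e.1)).image val := by
      ext m
      simp only [Finset.mem_filter, Finset.mem_image]
      constructor
      · rintro ⟨hm, hd⟩
        rcases hS m hm with ⟨p, i, hp, hsp, hi, rfl⟩ | ⟨e', he', rfl⟩
        · have := hpd p i _ hp hsp hi (hfp _) (hf3 _) hd
          have := hfs (Sum.inl e.1)
          omega
        · rcases hvd _ _ (hfp _) hd with h1 | h1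
          · have := hf h1
            simp at this
            exact ⟨e', ⟨by rw [hE, Finset.mem_filter]; exact ⟨he', hm⟩, this.symm⟩, rfl⟩
          · exact absurd h1 (hlr _ _)
      · rintro ⟨e', ⟨he', h1⟩, rfl⟩
        refine ⟨hEim (Finset.mem_image_of_mem _ he'), ?_⟩
        rw [← h1]; exact ⟨_, rfl⟩
    have h4 := h3 _ (hfp (Sum.inl e.1))
    rw [h, Finset.card_image_of_injective _ hvinj] at h4
    apply Nat.le_of_dvd _ h4
    exact Finset.card_pos.2 ⟨e, Finset.mem_filter.2 ⟨he, rfl⟩⟩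
  have hdeg2 : ∀ e ∈ E, 3 ≤ (E.filter (fun e' => e'.2 = e.2)).card := by
    intro e he
    have h : S.filter (fun m => f (Sum.inr e.2) ∣ m) = (E.filter (fun e' => e'.2 = e.2)).image val := by
      ext m
      simp only [Finset.mem_filter, Finset.mem_image]
      constructor
      · rintro ⟨hm, hd⟩
        rcases hS m hm with ⟨p, i, hp, hsp, hi, rfl⟩ | ⟨e', he', rfl⟩
        · have := hpd p i _ hp hsp hi (hfp _) (hf3 _) hd
          have := hfs (Sum.inr e.2)
          omega
        · rcases hvd _ _ (hfp _) hd with h1 | h1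
          · exact absurd h1.symm (hlr _ _)
          · have := hf h1
            simp at this
            exact ⟨e', ⟨by rw [hE, Finset.mem_filter]; exact ⟨he', hm⟩, this.symm⟩, rfl⟩
      · rintro ⟨e', ⟨he', h1⟩, rfl⟩
        refine ⟨hEim (Finset.mem_image_of_mem _ he'), ?_⟩
        rw [← h1]; exact ⟨_, mul_comm _ _⟩
    have h4 := h3 _ (hfp (Sum.inr e.2))
    rw [h, Finset.card_image_of_injective _ hvinj] at h4
    apply Nat.le_of_dvd _ h4
    exact Finset.card_pos.2 ⟨e, Finset.mem_filter.2 ⟨he, rfl⟩⟩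
  have hE0 : E = ∅ := c4_small E (fun a a' b b' h1 h2 h3 h4 =>
    hC4 a a' b b' (Finset.mem_filter.1 h1).1 (Finset.mem_filter.1 h2).1
      (Finset.mem_filter.1 h3).1 (Finset.mem_filter.1 h4).1) hdeg1 hdeg2 hEcard
  have hS' : ∀ m ∈ S, ∃ p i, p.Prime ∧ s < p ∧ (i = 1 ∨ i = 2 ∨ i = 3) ∧ m = i * p := by
    intro m hm
    rcases hS m hm with h | ⟨e, he, rfl⟩
    · exact h
    · have : e ∈ E := by rw [hE, Finset.mem_filter]; exact ⟨he, hm⟩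
      rw [hE0] at this
      simp at this
  -- full triples
  have hfull : ∀ p i, p.Prime → s < p → (i = 1 ∨ i = 2 ∨ i = 3) → i * p ∈ S →
      1 * p ∈ S ∧ 2 * p ∈ S ∧ 3 * p ∈ S := by
    intro p i hp hsp hi hm
    have hsub : S.filter (fun m => p ∣ m) ⊆ {1 * p, 2 * p, 3 * p} := by
      intro m hm
      rw [Finset.mem_filter] at hm
      obtain ⟨p', i', hp', hsp', hi', rfl⟩ := hS' m hm.1
      have := hpd p' i' p hp' hsp' hi' hp (by omega) hm.2
      subst this
      rcases hi' with rfl | rfl | rfl <;> simp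
    have hge : 3 ≤ (S.filter (fun m => p ∣ m)).card := by
      apply Nat.le_of_dvd _ (h3 p hp)
      exact Finset.card_pos.2 ⟨i * p, Finset.mem_filter.2 ⟨hm, ⟨i, mul_comm _ _⟩⟩⟩
    have heq := Finset.eq_of_subset_of_card_le hsub (Finset.card_le_three.trans hge)
    have hin : ∀ y ∈ ({1 * p, 2 * p, 3 * p} : Finset ℕ), y ∈ S := by
      intro y hy
      rw [← heq] at hy
      exact (Finset.mem_filter.1 hy).1
    exact ⟨hin _ (by simp), hin _ (by simp), hin _ (by simp)⟩
  set Q := S.filter Nat.Prime with hQ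
  have hQm : ∀ p ∈ Q, p.Prime ∧ s < p ∧ 1 * p ∈ S ∧ 2 * p ∈ S ∧ 3 * p ∈ S := by
    intro p hp
    rw [hQ, Finset.mem_filter] at hp
    obtain ⟨hpS, hpp⟩ := hp
    obtain ⟨p', i', hp', hsp', hi', he⟩ := hS' p hpS
    have : p = p' := by
      have hd : p' ∣ p := ⟨i', by rw [he, mul_comm]⟩
      exact ((Nat.prime_dvd_prime_iff_eq hp' hpp).1 hd).symm
    subst this
    exact ⟨hpp, hsp', hfull p i' hp' hsp' hi' (he ▸ hpS)⟩
  have hSeq : S = Q ∪ (Q.image (2 * ·) ∪ Q.image (3 * ·)) := by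
    ext m
    simp only [Finset.mem_union, Finset.mem_image]
    constructor
    · intro hm
      obtain ⟨p, i, hp, hsp, hi, rfl⟩ := hS' m hm
      have hpQ : p ∈ Q := by
        rw [hQ, Finset.mem_filter]
        refine ⟨?_, hp⟩
        simpa using (hfull p i hp hsp hi hm).1
      rcases hi with rfl | rfl | rfl
      · left; simpa using hpQ
      · right; left; exact ⟨p, hpQ, rfl⟩
      · right; right; exact ⟨p, hpQ, rfl⟩
    · rintro (h | ⟨p, hp, rfl⟩ | ⟨p, hp, rfl⟩)
      · simpa using (hQm m h).2.2.1
      · exact (hQm p hp).2.2.2.1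
      · exact (hQm p hp).2.2.2.2
  have h2f : S.filter (fun m => 2 ∣ m) = Q.image (2 * ·) := by
    ext m
    simp only [Finset.mem_filter, Finset.mem_image]
    constructor
    · rintro ⟨hm, hd⟩
      obtain ⟨p, i, hp, hsp, hi, rfl⟩ := hS' m hm
      have hpQ : p ∈ Q := by
        rw [hQ, Finset.mem_filter]
        refine ⟨?_, hp⟩
        simpa using (hfull p i hp hsp hi hm).1
      have hp2 : ¬ 2 ∣ p := fun h => by
        have := (Nat.prime_dvd_prime_iff_eq Nat.prime_two hp).1 h
        omega
      rcases hi with rfl | rfl | rfl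
      · omega
      · exact ⟨p, hpQ, rfl⟩
      · omega
    · rintro ⟨p, hp, rfl⟩
      exact ⟨(hQm p hp).2.2.2.1, ⟨p, rfl⟩⟩
  have hc2 : (Q.image (2 * ·)).card = Q.card :=
    Finset.card_image_of_injective _ (fun a b h => by simpa using h)
  have hc3 : (Q.image (3 * ·)).card = Q.card :=
    Finset.card_image_of_injective _ (fun a b h => by simpa using h)
  have hd2 := h3 2 Nat.prime_two
  rw [h2f, hc2] at hd2
  have hodd : ∀ p ∈ Q, ¬ 2 ∣ p ∧ ¬ 3 ∣ p := by
    intro p hp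
    obtain ⟨hpp, hsp, _⟩ := hQm p hp
    constructor
    · intro h
      have := (Nat.prime_dvd_prime_iff_eq Nat.prime_two hpp).1 h
      omega
    · intro h
      have := (Nat.prime_dvd_prime_iff_eq Nat.prime_three hpp).1 h
      omega
  rw [hSeq, Finset.card_union_of_disjoint, Finset.card_union_of_disjoint, hc2, hc3] at hcard
  · omega
  · rw [Finset.disjoint_left]
    intro m h1 h2
    rw [Finset.mem_image] at h1 h2
    obtain ⟨p, hp, rfl⟩ := h1
    obtain ⟨p', hp', h⟩ := h2
    have := hodd p' hp'
    omega
  · rw [Finset.disjoint_left]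
    intro m h1 h2
    have := hodd m h1
    rw [Finset.mem_union, Finset.mem_image, Finset.mem_image] at h2
    rcases h2 with ⟨p, _, rfl⟩ | ⟨p, _, rfl⟩
    · exact this.1 ⟨p, rfl⟩
    · exact this.2 ⟨p, rfl⟩

lemma Fkd_bdd (k d n : ℕ) : BddAbove {m : ℕ | ∃ A : Finset ℕ, A ⊆ Finset.Icc 1 n ∧ A.card = m ∧
    ∀ (a : Fin k → ℕ) (x : ℕ), (∀ i, a i ∈ A) → StrictMono a → 0 < x →
      (∏ i, a i) ≠ x ^ d} := by
  refine ⟨n, ?_⟩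
  rintro m ⟨A, hA, rfl, _⟩
  simpa using Finset.card_le_card hA

lemma exists_graph (q : ℕ) (hq : q.Prime) :
    ∃ G : Finset ((ZMod q × ZMod q) × (ZMod q × ZMod q)), G.card = q ^ 3 ∧
    ∀ a a' b b', (a, b) ∈ G → (a, b') ∈ G → (a', b) ∈ G → (a', b') ∈ G → a = a' ∨ b = b' := by
  haveI : Fact q.Prime := ⟨hq⟩
  classical
  let g : ZMod q × ZMod q × ZMod q → (ZMod q × ZMod q) × (ZMod q × ZMod q) :=
    fun t => ((t.1, t.2.1 * t.1 + t.2.2), (t.2.1, t.2.2))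
  have hg : Function.Injective g := by
    rintro ⟨x, m, b⟩ ⟨x', m', b'⟩ h
    simp only [g, Prod.mk.injEq] at h
    obtain ⟨⟨rfl, _⟩, rfl, rfl⟩ := h
    rfl
  refine ⟨Finset.univ.image g, ?_, ?_⟩
  · rw [Finset.card_image_of_injective _ hg, Finset.card_univ]
    simp [ZMod.card]
    ring
  · have hmem : ∀ x y m b, (((x, y), (m, b)) : (ZMod q × ZMod q) × (ZMod q × ZMod q))
        ∈ Finset.univ.image g → y = m * x + b := by
      intro x y m b h
      simp only [g, Finset.mem_image, Finset.mem_univ, true_and, Prod.exists, Prod.mk.injEq] at h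
      obtain ⟨x', m', b', ⟨rfl, rfl⟩, rfl, rfl⟩ := h
      rfl
    rintro ⟨x, y⟩ ⟨x', y'⟩ ⟨m, b⟩ ⟨m', b'⟩ h1 h2 h3 h4
    have e1 := hmem _ _ _ _ h1
    have e2 := hmem _ _ _ _ h2
    have e3 := hmem _ _ _ _ h3
    have e4 := hmem _ _ _ _ h4
    have : (m - m') * (x - x') = 0 := by linear_combination e2 - e1 + e3 - e4
    rcases mul_eq_zero.1 this with h | h
    · right
      have hm : m = m' := sub_eq_zero.1 h
      subst hm
      have : b = b' := by linear_combination e2 - e1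
      rw [this]
    · left
      have hm : x = x' := sub_eq_zero.1 h
      subst hm
      have : y = y' := by linear_combination e1 - e3
      rw [this]

lemma lower_comb (n q : ℕ) (hn : 9 ≤ n) (hq : q.Prime)
    (hq2 : 2 * q ^ 2 + 2 ≤ (Nat.sqrt n).primeCounting) :
    n.primeCounting + (n / 2).primeCounting + (n / 3).primeCounting + q ^ 3
      ≤ Fkd 12 3 n + 3 * (Nat.sqrt n).primeCounting := by
  classical
  haveI : Fact q.Prime := ⟨hq⟩
  obtain ⟨G, hG, hC4⟩ := exists_graph q hq
  set s := Nat.sqrt n with hs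
  have hs3 : 3 ≤ s := by rw [hs, Nat.le_sqrt]; omega
  have hss : s * s ≤ n := Nat.sqrt_le n
  -- embedding
  set R := (Nat.primesLE s).filter (fun p => 3 < p) with hR
  have hRc : 2 * q ^ 2 ≤ R.card := by
    have h1 : Nat.primesLE s ⊆ R ∪ {2, 3} := by
      intro p hp
      have h2 := (Nat.mem_primesLE.1 hp).2.two_le
      simp only [hR, Finset.mem_union, Finset.mem_filter, hp, true_and, Finset.mem_insert,
        Finset.mem_singleton]
      omega
    have h2 := (Finset.card_le_card h1).trans (Finset.card_union_le _ _)
    rw [Nat.primesLE_card_eq_primeCounting] at h2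
    have : ({2, 3} : Finset ℕ).card = 2 := by decide
    omega
  have hemb : Nonempty (((ZMod q × ZMod q) ⊕ (ZMod q × ZMod q)) ↪ R) := by
    apply Function.Embedding.nonempty_of_card_le
    simp [ZMod.card]
    nlinarith
  obtain ⟨φ⟩ := hemb
  let f : (ZMod q × ZMod q) ⊕ (ZMod q × ZMod q) → ℕ := fun c => (φ c : ℕ)
  have hf : Function.Injective f := fun a b h => φ.injective (Subtype.ext h)
  have hfR : ∀ c, f c ∈ R := fun c => (φ c).2
  have hfp : ∀ c, (f c).Prime := fun c =>
    (Nat.mem_primesLE.1 (Finset.mem_filter.1 (hfR c)).1).2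
  have hfs : ∀ c, f c ≤ s := fun c =>
    (Nat.mem_primesLE.1 (Finset.mem_filter.1 (hfR c)).1).1
  have hf3 : ∀ c, 3 < f c := fun c => (Finset.mem_filter.1 (hfR c)).2
  have hlr : ∀ a b, f (Sum.inl a) ≠ f (Sum.inr b) := fun a b h => by simpa using hf h
  let val : (ZMod q × ZMod q) × (ZMod q × ZMod q) → ℕ :=
    fun e => f (Sum.inl e.1) * f (Sum.inr e.2)
  have hvd : ∀ (e : (ZMod q × ZMod q) × (ZMod q × ZMod q)) (r : ℕ), r.Prime → r ∣ val e →
      r = f (Sum.inl e.1) ∨ r = f (Sum.inr e.2) := by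
    intro e r hr hd
    rcases hr.dvd_mul.1 hd with h | h
    · exact Or.inl ((Nat.prime_dvd_prime_iff_eq hr (hfp _)).1 h)
    · exact Or.inr ((Nat.prime_dvd_prime_iff_eq hr (hfp _)).1 h)
  have hvinj : Function.Injective val := by
    rintro ⟨a, b⟩ ⟨a', b'⟩ h
    have h1 : f (Sum.inl a) ∣ val (a', b') := by rw [← h]; exact ⟨_, rfl⟩
    have h2 : f (Sum.inr b) ∣ val (a', b') := by rw [← h]; exact ⟨_, mul_comm _ _⟩
    rcases hvd _ _ (hfp _) h1 with h1 | h1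
    · rcases hvd _ _ (hfp _) h2 with h2 | h2
      · exact absurd h2.symm (hlr _ _)
      · have e1 := hf h1
        have e2 := hf h2
        simp only [Sum.inl.injEq, Sum.inr.injEq] at e1 e2
        rw [e1, e2]
    · exact absurd h1 (hlr _ _)
  let Lp : ℕ → Finset ℕ := fun i => (Nat.primesLE (n / i)).filter (fun p => s < p)
  let L : ℕ → Finset ℕ := fun i => (Lp i).image (i * ·)
  have hLm : ∀ i m, m ∈ L i → ∃ p, p.Prime ∧ s < p ∧ m = i * p ∧ p ≤ n / i := by
    intro i m hm
    simp only [L, Lp, Finset.mem_image, Finset.mem_filter, Nat.mem_primesLE] at hm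
    obtain ⟨p, ⟨⟨h1, h2⟩, h3⟩, rfl⟩ := hm
    exact ⟨p, h2, h3, rfl, h1⟩
  have hLc : ∀ i, 1 ≤ i → (n / i).primeCounting ≤ (L i).card + s.primeCounting := by
    intro i hi
    have h1 : (L i).card = (Lp i).card :=
      Finset.card_image_of_injective _ (fun a b h => Nat.eq_of_mul_eq_mul_left (by omega) h)
    have h2 : Nat.primesLE (n / i) ⊆ Lp i ∪ Nat.primesLE s := by
      intro p hp
      have hp' := Nat.mem_primesLE.1 hp
      simp only [Lp, Finset.mem_union, Finset.mem_filter, hp, true_and, Nat.mem_primesLE, hp'.2,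
        and_true]
      omega
    have h3 := (Finset.card_le_card h2).trans (Finset.card_union_le _ _)
    rw [Nat.primesLE_card_eq_primeCounting, Nat.primesLE_card_eq_primeCounting] at h3
    omega
  let A : Finset ℕ := L 1 ∪ (L 2 ∪ (L 3 ∪ G.image val))
  have hodd : ∀ p, p.Prime → s < p → ¬ 2 ∣ p ∧ ¬ 3 ∣ p := by
    intro p hpp hsp
    constructor
    · intro h
      have := (Nat.prime_dvd_prime_iff_eq Nat.prime_two hpp).1 h
      omega
    · intro h
      have := (Nat.prime_dvd_prime_iff_eq Nat.prime_three hpp).1 h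
      omega
  have hLB : ∀ i, Disjoint (L i) (G.image val) := by
    intro i
    rw [Finset.disjoint_left]
    intro m hm hm'
    obtain ⟨p, hp, hsp, rfl, _⟩ := hLm i m hm
    rw [Finset.mem_image] at hm'
    obtain ⟨e, _, he⟩ := hm'
    have := hfs (Sum.inl e.1)
    have := hfs (Sum.inr e.2)
    rcases hvd e p hp (by rw [he]; exact ⟨i, mul_comm _ _⟩) with h | h <;> omega
  have hAcard : A.card = (L 1).card + ((L 2).card + ((L 3).card + q ^ 3)) := by
    simp only [A]
    rw [Finset.card_union_of_disjoint, Finset.card_union_of_disjoint,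
      Finset.card_union_of_disjoint (hLB 3), Finset.card_image_of_injective _ hvinj, hG]
    · rw [Finset.disjoint_union_right]
      refine ⟨?_, hLB 2⟩
      rw [Finset.disjoint_left]
      intro m h1 h2
      obtain ⟨p, hp, hsp, rfl, _⟩ := hLm _ m h1
      obtain ⟨p', hp', hsp', h, _⟩ := hLm _ _ h2
      have := hodd p' hp' hsp'
      omega
    · rw [Finset.disjoint_union_right, Finset.disjoint_union_right]
      refine ⟨?_, ?_, hLB 1⟩
      · rw [Finset.disjoint_left]
        intro m h1 h2
        obtain ⟨p, hp, hsp, rfl, _⟩ := hLm _ m h1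
        obtain ⟨p', hp', hsp', h, _⟩ := hLm _ _ h2
        have := hodd p hp hsp
        omega
      · rw [Finset.disjoint_left]
        intro m h1 h2
        obtain ⟨p, hp, hsp, rfl, _⟩ := hLm _ m h1
        obtain ⟨p', hp', hsp', h, _⟩ := hLm _ _ h2
        have := hodd p hp hsp
        omega
  have hAdesc : ∀ m ∈ A, (∃ p i, p.Prime ∧ s < p ∧ (i = 1 ∨ i = 2 ∨ i = 3) ∧ m = i * p ∧
      p ≤ n / i) ∨ ∃ e ∈ G, m = f (Sum.inl e.1) * f (Sum.inr e.2) := by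
    intro m hm
    simp only [A, Finset.mem_union] at hm
    rcases hm with hm | hm | hm | hm
    · obtain ⟨p, h1, h2, h3⟩ := hLm _ m hm
      exact Or.inl ⟨p, 1, h1, h2, by simp, h3⟩
    · obtain ⟨p, h1, h2, h3⟩ := hLm _ m hm
      exact Or.inl ⟨p, 2, h1, h2, by simp, h3⟩
    · obtain ⟨p, h1, h2, h3⟩ := hLm _ m hm
      exact Or.inl ⟨p, 3, h1, h2, by simp, h3⟩
    · rw [Finset.mem_image] at hm
      obtain ⟨e, he, h⟩ := hm
      exact Or.inr ⟨e, he, h.symm⟩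
  have hAn : A ⊆ Finset.Icc 1 n := by
    intro m hm
    rw [Finset.mem_Icc]
    rcases hAdesc m hm with ⟨p, i, hp, hsp, hi, rfl, hpn⟩ | ⟨e, he, rfl⟩
    · have hi1 : 1 ≤ i := by omega
      refine ⟨Nat.mul_pos hi1 hp.pos, ?_⟩
      rw [Nat.le_div_iff_mul_le (by omega)] at hpn
      rw [mul_comm]; exact hpn
    · exact ⟨Nat.mul_pos (hfp _).pos (hfp _).pos, (Nat.mul_le_mul (hfs _) (hfs _)).trans hss⟩
  have hle : A.card ≤ Fkd 12 3 n := by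
    apply le_csSup (Fkd_bdd 12 3 n)
    refine ⟨A, hAn, rfl, ?_⟩
    intro a x ha hmono hx heq
    refine no_cube_construction G hC4 s hs3 f hf hfp hf3 hfs (Finset.univ.image a) ?_ ?_ x ?_
    · intro m hm
      rw [Finset.mem_image] at hm
      obtain ⟨i, _, rfl⟩ := hm
      rcases hAdesc _ (ha i) with ⟨p, i, hp, hsp, hi, h, hpn⟩ | h
      · exact Or.inl ⟨p, i, hp, hsp, hi, h⟩
      · exact Or.inr h
    · rw [Finset.card_image_of_injective _ hmono.injective]; simp
    · rw [Finset.prod_image hmono.injective.injOn, heq]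
  have h1 := hLc 1 le_rfl
  have h2 := hLc 2 (by norm_num)
  have h3 := hLc 3 (by norm_num)
  rw [Nat.div_one] at h1
  omega

lemma exists_q (N : ℕ) (hN : 10 ≤ N) : ∃ q, q.Prime ∧ 2 * q ^ 2 + 2 ≤ N ∧ N ≤ 8 * q ^ 2 + 2 := by
  set k := Nat.sqrt ((N - 2) / 8) with hk
  have hk1 : k * k ≤ (N - 2) / 8 := Nat.sqrt_le _
  have hk2 : (N - 2) / 8 < (k + 1) * (k + 1) := Nat.lt_succ_sqrt _
  have hk0 : k ≠ 0 := by
    intro h0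
    rw [h0] at hk2
    omega
  obtain ⟨q, hq, h1, h2⟩ := Nat.exists_prime_lt_and_le_two_mul k hk0
  refine ⟨q, hq, ?_, ?_⟩
  · have : q ^ 2 ≤ 4 * (k * k) := by nlinarith
    omega
  · have : (k + 1) * (k + 1) ≤ q ^ 2 := by nlinarith
    omega

lemma pi_lower_s12 (n : ℕ) (hn : 40000 ≤ n) :
    (n:ℝ) ^ ((1:ℝ)/2) / (8 * Real.log n) ≤ ((Nat.sqrt n).primeCounting : ℝ) := by
  set s := Nat.sqrt n with hs
  have hs200 : 200 ≤ s := by rw [hs, Nat.le_sqrt]; omega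
  have hsR : (200:ℝ) ≤ s := by exact_mod_cast hs200
  have h := Chebyshev.pi_ge s
  have hsn : s ≤ n := Nat.sqrt_le_self n
  have hlogs : 0 < Real.log s := Real.log_pos (by linarith)
  have hlogn : Real.log s ≤ Real.log n := Real.log_le_log (by linarith) (by exact_mod_cast hsn)
  have h1 : Real.log ((s:ℝ) + 1) ≤ s / 5 := by
    have e1 : Real.log ((s:ℝ) + 1) = 2 * Real.log (Real.sqrt ((s:ℝ)+1)) := by
      rw [Real.log_sqrt (by linarith)]; ring
    have e2 : Real.log (Real.sqrt ((s:ℝ)+1)) ≤ Real.sqrt ((s:ℝ)+1) - 1 :=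
      Real.log_le_sub_one_of_pos (Real.sqrt_pos.2 (by linarith))
    have e3 : Real.sqrt ((s:ℝ)+1) ≤ s / 10 + 1 := by
      apply Real.sqrt_le_iff.2
      constructor
      · linarith
      · nlinarith
    linarith
  have h2 := Real.log_two_gt_d9
  have h3 : (s:ℝ) / 4 ≤ s * Real.log 2 - Real.log ((s:ℝ) + 1) := by nlinarith
  have h4 : (n:ℝ) ^ ((1:ℝ)/2) ≤ 2 * s := by
    rw [← Real.sqrt_eq_rpow]
    apply Real.sqrt_le_iff.2
    refine ⟨by linarith, ?_⟩
    have : n < (s + 1) * (s + 1) := Nat.lt_succ_sqrt n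
    have : (n:ℝ) < (s + 1) * (s + 1) := by exact_mod_cast this
    nlinarith
  refine le_trans ?_ h
  calc (n:ℝ) ^ ((1:ℝ)/2) / (8 * Real.log n) ≤ (2 * s) / (8 * Real.log s) := by gcongr
    _ = (s / 4) / Real.log s := by field_simp; norm_num
    _ ≤ _ := by gcongr

theorem stmt_12 : ∃ c1 c2 : ℝ, 0 < c1 ∧ 0 < c2 ∧ ∀ᶠ n : ℕ in Filter.atTop,
    (Nat.primeCounting n : ℝ) + (Nat.primeCounting (n / 2) : ℝ)
        + (Nat.primeCounting (n / 3) : ℝ)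
        + c1 * (n : ℝ) ^ ((3 : ℝ)/4) / (Real.log n) ^ ((3 : ℝ)/2)
        ≤ (Fkd 12 3 n : ℝ) ∧
    (Fkd 12 3 n : ℝ)
        ≤ (Nat.primeCounting n : ℝ) + (Nat.primeCounting (n / 2) : ℝ)
            + (Nat.primeCounting (n / 3) : ℝ) + c2 * (n : ℝ) ^ ((5 : ℝ)/6) := by
  refine ⟨1 / 8192, 5000000, by norm_num, by norm_num, ?_⟩
  have hsq : Tendsto Nat.sqrt atTop atTop := by
    apply Filter.tendsto_atTop_mono' atTop (f₁ := fun n => Nat.sqrt n) (Eventually.of_forall fun _ => le_rfl)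
    rw [Filter.tendsto_atTop]
    intro b
    filter_upwards [eventually_ge_atTop (b * b)] with n hn
    exact Nat.le_sqrt.2 hn
  have hpi := (Nat.tendsto_primeCounting.comp hsq).eventually_ge_atTop 160000
  filter_upwards [eventually_ge_atTop 40000, hpi] with n hn hN
  constructor
  · simp only [Function.comp] at hN
    obtain ⟨q, hq, h1, h2⟩ := exists_q (Nat.sqrt n).primeCounting (by omega)
    have h3 := lower_comb n q (by omega) hq h1
    have h4 := pi_lower_s12 n hn
    set N := (Nat.sqrt n).primeCounting with hNdef
    have h3' : (n.primeCounting : ℝ) + (n / 2).primeCounting + (n / 3).primeCounting + (q:ℝ) ^ 3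
      ≤ Fkd 12 3 n + 3 * (N:ℝ) := by exact_mod_cast h3
    have hNR : (160000:ℝ) ≤ N := by exact_mod_cast hN
    have h2' : (N:ℝ) ≤ 8 * (q:ℝ)^2 + 2 := by exact_mod_cast h2
    set r := Real.sqrt N with hr
    have hrr : r ^ 2 = N := Real.sq_sqrt (by linarith)
    have hr400 : 400 ≤ r := Real.le_sqrt_of_sq_le (by linarith)
    have hq4 : r / 4 ≤ q := by
      have hq0 : (0:ℝ) ≤ q := Nat.cast_nonneg q
      nlinarith
    have hq3 : (r / 4) ^ 3 ≤ (q:ℝ) ^ 3 := by gcongr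
    have hmain : r ^ 3 / 128 ≤ (q:ℝ)^3 - 3 * N := by
      rw [← hrr]
      nlinarith [sq_nonneg r]
    have hlog : 0 < Real.log n := Real.log_pos (by exact_mod_cast (by omega : 1 < n))
    have hn0 : (0:ℝ) < n := by exact_mod_cast (by omega : 0 < n)
    have hr3 : r ^ 3 = (N:ℝ) ^ ((3:ℝ)/2) := by
      rw [hr, Real.sqrt_eq_rpow, ← Real.rpow_natCast, ← Real.rpow_mul (by linarith)]; norm_num
    have hlow : (n:ℝ) ^ ((3:ℝ)/4) / (64 * (Real.log n) ^ ((3:ℝ)/2)) ≤ r ^ 3 := by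
      rw [hr3]
      have e1 : ((n:ℝ) ^ ((1:ℝ)/2) / (8 * Real.log n)) ^ ((3:ℝ)/2) ≤ (N:ℝ) ^ ((3:ℝ)/2) := by
        gcongr
      rw [Real.div_rpow (by positivity) (by positivity), Real.mul_rpow (by norm_num) hlog.le,
        ← Real.rpow_mul hn0.le] at e1
      refine le_trans ?_ e1
      have e2 : (8:ℝ) ^ ((3:ℝ)/2) ≤ 64 := by
        calc (8:ℝ) ^ ((3:ℝ)/2) ≤ (8:ℝ) ^ (2:ℝ) :=
              Real.rpow_le_rpow_of_exponent_le (by norm_num) (by norm_num)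
          _ = 64 := by norm_num
      have e3 : (1:ℝ)/2 * (3/2) = 3/4 := by norm_num
      rw [e3]
      gcongr
    have hfin : 1 / 8192 * (n : ℝ) ^ ((3 : ℝ)/4) / (Real.log n) ^ ((3 : ℝ)/2)
        = (n:ℝ) ^ ((3:ℝ)/4) / (64 * (Real.log n) ^ ((3:ℝ)/2)) / 128 := by
      have : 0 < (Real.log n) ^ ((3:ℝ)/2) := by positivity
      field_simp
      norm_num
    rw [hfin]
    linarith
  · have hne : {m : ℕ | ∃ A : Finset ℕ, A ⊆ Finset.Icc 1 n ∧ A.card = m ∧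
        ∀ (a : Fin 12 → ℕ) (x : ℕ), (∀ i, a i ∈ A) → StrictMono a → 0 < x →
        (∏ i, a i) ≠ x ^ 3}.Nonempty := by
      refine ⟨0, ∅, by simp, by simp, ?_⟩
      intro a x ha
      exact absurd (ha 0) (by simp)
    obtain ⟨A, hAn, hAc, hA⟩ := Nat.sSup_mem hne (Fkd_bdd 12 3 n)
    have := upper_bound_s12 n (by omega) A hAn hA
    rw [hAc] at this
    exact this
end
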